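/- For all real α, β > −1 and every δ ∈ (0, π/2) there exist constants C > 0 and N ∈ ℕ such that for all n ≥ N and all θ ∈ [δ, π−δ], writing x = cos θ, κ = n + (α+β+1)/2 and χ = κθ − (α/2 + 1/4)π, one has |√(πκ) · (sin(θ/2))^{α+1/2} (cos(θ/2))^{β+1/2} · P_n^{(α,β)}(x) − [cos χ · (1 − αβ/(2κ)) − sin χ · (2α² − 2β² + (2α² + 2β² − 1)x)/(8κ sin θ)]| ≤ C/κ². -/

import Mathlib

open Real

/-- The Jacobi polynomial `P_n^{(α,β)}(x)` defined by its explicit sum. -/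
noncomputable def jacobiP (α β : ℝ) (n : ℕ) (x : ℝ) : ℝ :=
  ∑ ℓ ∈ Finset.range (n + 1),
    ((ascPochhammer ℝ ℓ).eval ((n : ℝ) + α + β + 1) *
        (ascPochhammer ℝ (n - ℓ)).eval (α + (ℓ : ℝ) + 1)) /
      ((Nat.factorial ℓ : ℝ) * (Nat.factorial (n - ℓ) : ℝ)) * ((x - 1) / 2) ^ ℓ

/-- If the increments of a null sequence `f` are dominated by the decrements of a null sequence
`g`, then `f` is dominated by `g`. -/
theorem abs_le_of_abs_sub_succ_le {f g : ℕ → ℝ} {N : ℕ}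
    (hf : Filter.Tendsto f Filter.atTop (nhds 0)) (hg : Filter.Tendsto g Filter.atTop (nhds 0))
    (h : ∀ n, N ≤ n → |f (n + 1) - f n| ≤ g n - g (n + 1)) (n : ℕ) (hn : N ≤ n) :
    |f n| ≤ g n := by
  have key : ∀ m, |f (n + m) - f n| ≤ g n - g (n + m) := by
    intro m
    induction m with
    | zero => simp
    | succ m ih =>
      have h1 := h (n + m) (by omega)
      have h2 := abs_sub_le (f (n + (m + 1))) (f (n + m)) (f n)
      rw [← add_assoc] at *
      linarith
  have hs : Filter.Tendsto (fun m => n + m) Filter.atTop Filter.atTop :=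
    Filter.tendsto_atTop_mono (fun m => Nat.le_add_left m n) Filter.tendsto_id
  have h1 := ((hf.comp hs).sub_const (f n)).abs
  have h2 := (hg.comp hs).const_sub (g n)
  simpa using le_of_tendsto_of_tendsto' h1 h2 key

theorem tendsto_const_div_natCast_add (C k : ℝ) :
    Filter.Tendsto (fun n : ℕ => C / ((n : ℝ) + k)) Filter.atTop (nhds 0) :=
  Filter.Tendsto.const_div_atTop
    (Filter.tendsto_atTop_add_const_right _ k tendsto_natCast_atTop_atTop) C

theorem eventually_le_natCast_add (b k : ℝ) :
    ∀ᶠ n : ℕ in Filter.atTop, b ≤ (n : ℝ) + k :=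
  (Filter.tendsto_atTop_add_const_right _ k tendsto_natCast_atTop_atTop).eventually_ge_atTop b

theorem abs_ratio_sub_le {σ M : ℝ} (h1 : 1 ≤ M) (h2 : 2 * σ ≤ M) :
    |(M - 1 / 4) * M / (M - σ) ^ 2 - 1 + (1 / 4 - 2 * σ) / M| ≤
      4 * (|σ ^ 2 + 2 * (1 / 4 - 2 * σ) * σ| + |(1 / 4 - 2 * σ) * σ ^ 2|) / M ^ 2 := by
  have hM : 0 < M := by linarith
  have hMσ : 0 < M - σ := by linarith
  have e : (M - 1 / 4) * M / (M - σ) ^ 2 - 1 + (1 / 4 - 2 * σ) / M =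
      (-(σ ^ 2 + 2 * (1 / 4 - 2 * σ) * σ) * M + (1 / 4 - 2 * σ) * σ ^ 2) / (M * (M - σ) ^ 2) := by
    field_simp
    ring
  rw [e, abs_div, abs_of_pos (by positivity : 0 < M * (M - σ) ^ 2), div_le_div_iff₀ (by positivity)
    (by positivity)]
  set X := |σ ^ 2 + 2 * (1 / 4 - 2 * σ) * σ|
  set Y := |(1 / 4 - 2 * σ) * σ ^ 2|
  have hX : 0 ≤ X := abs_nonneg _
  have hY : 0 ≤ Y := abs_nonneg _
  have hnum : |(-(σ ^ 2 + 2 * (1 / 4 - 2 * σ) * σ) * M + (1 / 4 - 2 * σ) * σ ^ 2)| ≤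
      (X + Y) * M := by
    refine (abs_add_le _ _).trans ?_
    rw [abs_mul, abs_neg, abs_of_pos hM]
    nlinarith
  have hsq : M ^ 2 ≤ 4 * (M - σ) ^ 2 := by nlinarith
  calc _ ≤ (X + Y) * M * M ^ 2 := by gcongr
    _ ≤ (X + Y) * M * (4 * (M - σ) ^ 2) := by gcongr
    _ = _ := by ring

theorem div_mul_sq_le_sub_div_sq {C κ : ℝ} (hC : 0 ≤ C) (hκ : 1 ≤ κ) :
    C / (κ * (κ + 1 / 2) ^ 2) ≤ C / κ ^ 2 - C / (κ + 1) ^ 2 := by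
  have hκ0 : 0 < κ := by linarith
  have e : C / κ ^ 2 - C / (κ + 1) ^ 2 = C * ((2 * κ + 1) / (κ ^ 2 * (κ + 1) ^ 2)) := by
    field_simp
    ring
  rw [e, div_eq_mul_one_div]
  refine mul_le_mul_of_nonneg_left ?_ hC
  rw [div_le_div_iff₀ (by positivity) (by positivity)]
  have h : κ * (κ + 1) ^ 2 ≤ (2 * κ + 1) * (κ + 1 / 2) ^ 2 := by nlinarith [sq_nonneg κ]
  calc 1 * (κ ^ 2 * (κ + 1) ^ 2) = κ * (κ * (κ + 1) ^ 2) := by ring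
    _ ≤ κ * ((2 * κ + 1) * (κ + 1 / 2) ^ 2) := mul_le_mul_of_nonneg_left h hκ0.le
    _ = _ := by ring

/-- Second order asymptotics of a sequence from the second order asymptotics of its ratios. -/
theorem exists_abs_sub_le_of_ratio {A : ℕ → ℝ} {k σ : ℝ}
    (hA : Filter.Tendsto A Filter.atTop (nhds 1))
    (hR : ∀ᶠ n : ℕ in Filter.atTop, A (n + 1) =
      A n * ((((n : ℝ) + k + 1 / 2) ^ 2 - 1 / 4) * ((n : ℝ) + k + 1 / 2) ^ 2 /
        (((n : ℝ) + k + 1 / 2) ^ 2 - σ) ^ 2)) :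
    ∃ C : ℝ, ∀ᶠ n : ℕ in Filter.atTop,
      |A n - 1 - (1 / 4 - 2 * σ) / ((n : ℝ) + k)| ≤ C / ((n : ℝ) + k) ^ 2 := by
  set d := 1 / 4 - 2 * σ with hd
  set C0 := 4 * (|σ ^ 2 + 2 * d * σ| + |d * σ ^ 2|) with hC0
  have hC0' : 0 ≤ C0 := by positivity
  set C1 := 2 * |d| + 2 * C0 with hC1
  have hC1' : 0 ≤ C1 := by positivity
  have hA2 : ∀ᶠ n in Filter.atTop, |A n| ≤ 2 := by
    have := hA.abs
    rw [abs_one] at this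
    exact this.eventually_le_const (by norm_num)
  have hall := hR.and (hA2.and ((eventually_le_natCast_add 1 k).and
    (eventually_le_natCast_add (2 * σ) k)))
  obtain ⟨N, hN⟩ := Filter.eventually_atTop.1 hall
  have step : ∀ n, N ≤ n → |A (n + 1) - A n + A n * d / ((n : ℝ) + k + 1 / 2) ^ 2| ≤
      2 * C0 / (((n : ℝ) + k + 1 / 2) ^ 2) ^ 2 := by
    intro n hn
    obtain ⟨h1, h2, h3, h4⟩ := hN n hn
    have hM : 1 ≤ ((n : ℝ) + k + 1 / 2) ^ 2 := by nlinarith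
    have hM2 : 2 * σ ≤ ((n : ℝ) + k + 1 / 2) ^ 2 := by nlinarith
    have hb := abs_ratio_sub_le hM hM2
    rw [← hd, ← hC0] at hb
    rw [h1]
    generalize ((n : ℝ) + k + 1 / 2) ^ 2 = M at *
    have e : A n * ((M - 1 / 4) * M / (M - σ) ^ 2) - A n + A n * d / M =
      A n * ((M - 1 / 4) * M / (M - σ) ^ 2 - 1 + d / M) := by ring
    rw [e, abs_mul, mul_div_assoc 2]
    exact mul_le_mul h2 hb (abs_nonneg _) zero_le_two
  have kpos : ∀ n, N ≤ n → 1 ≤ (n : ℝ) + k := fun n hn => (hN n hn).2.2.1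
  have first : ∀ n, N ≤ n → |A n - 1| ≤ C1 / ((n : ℝ) + k) := by
    refine abs_le_of_abs_sub_succ_le (by simpa using hA.sub_const 1)
      (tendsto_const_div_natCast_add C1 k) ?_
    intro n hn
    have hs := step n hn
    have hκ := kpos n hn
    have h2 := (hN n hn).2.1
    push_cast
    generalize hκ' : (n : ℝ) + k = κ at *
    have hκ1 : (n : ℝ) + 1 + k = κ + 1 := by rw [← hκ']; ring
    rw [hκ1]
    have hM1 : 1 ≤ (κ + 1 / 2) ^ 2 := by nlinarith
    have hMk : κ * (κ + 1) ≤ (κ + 1 / 2) ^ 2 := by nlinarith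
    generalize (κ + 1 / 2) ^ 2 = M at *
    have e1 : |A n * d / M| ≤ 2 * |d| / M := by
      rw [abs_div, abs_mul, abs_of_pos (by linarith : 0 < M)]
      gcongr
    have e2 : 2 * C0 / M ^ 2 ≤ 2 * C0 / M := by
      apply div_le_div_of_nonneg_left (by positivity) (by linarith)
      nlinarith
    have e3 : |A (n + 1) - A n| ≤ C1 / M := by
      have := abs_sub (A (n + 1) - A n + A n * d / M) (A n * d / M)
      rw [add_sub_cancel_right] at this
      have : C1 / M = 2 * |d| / M + 2 * C0 / M := by rw [hC1]; ring
      linarith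
    have e4 : C1 / κ - C1 / (κ + 1) = C1 / (κ * (κ + 1)) := by
      have : κ ≠ 0 := by linarith
      have : κ + 1 ≠ 0 := by linarith
      field_simp
      ring
    rw [e4, show A (n + 1) - 1 - (A n - 1) = A (n + 1) - A n by ring]
    refine e3.trans ?_
    apply div_le_div_of_nonneg_left hC1' (by positivity) hMk
  refine ⟨C1 * |d| + 2 * C0 + |d|, Filter.eventually_atTop.2 ⟨N, ?_⟩⟩
  set C2 := C1 * |d| + 2 * C0 + |d| with hC2
  have hC2' : 0 ≤ C2 := by positivity
  refine abs_le_of_abs_sub_succ_le ?_ ?_ ?_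
  · simpa using (hA.sub_const 1).sub (tendsto_const_div_natCast_add d k)
  · have := (tendsto_const_div_natCast_add C2 k).mul (tendsto_const_div_natCast_add 1 k)
    rw [mul_zero] at this
    refine this.congr fun n => ?_
    rw [div_mul_div_comm, mul_one, sq]
  intro n hn
  have hs := step n hn
  have hf := first n hn
  have hκ := kpos n hn
  push_cast
  generalize hκ' : (n : ℝ) + k = κ at *
  have hκ1 : (n : ℝ) + 1 + k = κ + 1 := by rw [← hκ']; ring
  rw [hκ1]
  have hκ0 : 0 < κ := by linarith
  have e : A (n + 1) - 1 - d / (κ + 1) - (A n - 1 - d / κ) =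
      (A (n + 1) - A n + A n * d / (κ + 1 / 2) ^ 2) - (A n - 1) * d / (κ + 1 / 2) ^ 2 +
        d * (1 / 4 / (κ * (κ + 1) * (κ + 1 / 2) ^ 2)) := by
    field_simp
    ring
  have hm : 0 < κ + 1 / 2 := by linarith
  have hMk : κ ≤ (κ + 1 / 2) ^ 2 := by nlinarith
  have b1 : 2 * C0 / ((κ + 1 / 2) ^ 2) ^ 2 ≤ 2 * C0 / (κ * (κ + 1 / 2) ^ 2) := by
    apply div_le_div_of_nonneg_left (by positivity) (by positivity)
    rw [sq ((κ + 1 / 2) ^ 2)]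
    gcongr
  have b2 : |(A n - 1) * d / (κ + 1 / 2) ^ 2| ≤ C1 * |d| / (κ * (κ + 1 / 2) ^ 2) := by
    rw [abs_div, abs_mul, abs_of_pos (by positivity : 0 < (κ + 1 / 2) ^ 2)]
    calc _ ≤ C1 / κ * |d| / (κ + 1 / 2) ^ 2 := by gcongr
      _ = _ := by field_simp
  have b3 : |d * (1 / 4 / (κ * (κ + 1) * (κ + 1 / 2) ^ 2))| ≤ |d| / (κ * (κ + 1 / 2) ^ 2) := by
    rw [abs_mul, abs_of_pos (by positivity : 0 < (1 / 4 / (κ * (κ + 1) * (κ + 1 / 2) ^ 2))),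
      div_eq_mul_one_div |d|]
    gcongr
    · norm_num
    · nlinarith
  have b4 := div_mul_sq_le_sub_div_sq hC2' hκ
  rw [e]
  have t1 := abs_add_le ((A (n + 1) - A n + A n * d / (κ + 1 / 2) ^ 2) -
    (A n - 1) * d / (κ + 1 / 2) ^ 2) (d * (1 / 4 / (κ * (κ + 1) * (κ + 1 / 2) ^ 2)))
  have t2 := abs_sub (A (n + 1) - A n + A n * d / (κ + 1 / 2) ^ 2)
    ((A n - 1) * d / (κ + 1 / 2) ^ 2)
  have t3 : C2 / (κ * (κ + 1 / 2) ^ 2) = C1 * |d| / (κ * (κ + 1 / 2) ^ 2) +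
    2 * C0 / (κ * (κ + 1 / 2) ^ 2) + |d| / (κ * (κ + 1 / 2) ^ 2) := by rw [hC2]; ring
  linarith

/-- Passing to square roots in a second order expansion. -/
theorem exists_abs_sqrt_sub_le {A : ℕ → ℝ} {k c C : ℝ}
    (hA0 : ∀ᶠ n in Filter.atTop, 0 ≤ A n)
    (hA : ∀ᶠ n : ℕ in Filter.atTop,
      |A n - 1 - 2 * c / ((n : ℝ) + k)| ≤ C / ((n : ℝ) + k) ^ 2) :
    ∃ C' : ℝ, ∀ᶠ n : ℕ in Filter.atTop,
      |√(A n) - 1 - c / ((n : ℝ) + k)| ≤ C' / ((n : ℝ) + k) ^ 2 := by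
  refine ⟨2 * (C + c ^ 2), ?_⟩
  filter_upwards [hA, eventually_le_natCast_add 1 k, eventually_le_natCast_add (2 * |c|) k, hA0]
    with n h1 h2 h3 h4
  generalize (n : ℝ) + k = κ at *
  have hκ : 0 < κ := by linarith
  have hc : |c / κ| ≤ 1 / 2 := by
    rw [abs_div, abs_of_pos hκ, div_le_iff₀ hκ]; linarith
  have hs := Real.sqrt_nonneg (A n)
  have hsq := Real.sq_sqrt h4
  set r := √(A n)
  have hden : 1 / 2 ≤ r + 1 + c / κ := by linarith [neg_abs_le (c / κ)]
  have e : (r - 1 - c / κ) * (r + 1 + c / κ) = (A n - 1 - 2 * c / κ) - c ^ 2 / κ ^ 2 := by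
    rw [← hsq]; field_simp; ring
  have h5 : |r - 1 - c / κ| * (1 / 2) ≤ C / κ ^ 2 + c ^ 2 / κ ^ 2 := by
    calc _ ≤ |r - 1 - c / κ| * |r + 1 + c / κ| := by
          gcongr; exact hden.trans (le_abs_self _)
      _ = |(A n - 1 - 2 * c / κ) - c ^ 2 / κ ^ 2| := by rw [← abs_mul, e]
      _ ≤ |A n - 1 - 2 * c / κ| + |c ^ 2 / κ ^ 2| := abs_sub _ _
      _ ≤ _ := by rw [abs_of_nonneg (by positivity : 0 ≤ c ^ 2 / κ ^ 2)]; gcongr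
  have : 2 * (C + c ^ 2) / κ ^ 2 = 2 * (C / κ ^ 2 + c ^ 2 / κ ^ 2) := by ring
  linarith

theorem ascPochhammer_eval_eq_prod (n : ℕ) (x : ℝ) :
    (ascPochhammer ℝ n).eval x = ∏ j ∈ Finset.range n, (x + j) := by
  induction n with
  | zero => simp
  | succ n ih => rw [ascPochhammer_succ_eval, ih, Finset.prod_range_succ]

/-- The leading coefficient of the Jacobi polynomial of degree `n` in the variable `(x - 1) / 2`,
scaled by `2 ^ (-s) * 4 ^ (-n)`, where `s = α + β`. -/
noncomputable def scaledLeadingCoeff (s : ℝ) (n : ℕ) : ℝ :=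
  (ascPochhammer ℝ n).eval ((n : ℝ) + s + 1) / ((n.factorial : ℝ) * 4 ^ n * 2 ^ s)

theorem scaledLeadingCoeff_pos {s : ℝ} (hs : -2 < s) {n : ℕ} (hn : 1 ≤ n) :
    0 < scaledLeadingCoeff s n := by
  have : (1 : ℝ) ≤ n := by exact_mod_cast hn
  have := ascPochhammer_pos n ((n : ℝ) + s + 1) (by linarith)
  unfold scaledLeadingCoeff
  positivity

theorem scaledLeadingCoeff_succ {s : ℝ} (hs : -2 < s) {n : ℕ} (hn : 1 ≤ n) :
    scaledLeadingCoeff s (n + 1) = scaledLeadingCoeff s n *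
      ((2 * n + s + 1) * (2 * n + s + 2) / (4 * (n + s + 1) * (n + 1))) := by
  have hn' : (1 : ℝ) ≤ n := by exact_mod_cast hn
  have h0 : (n : ℝ) + s + 1 ≠ 0 := by linarith
  have key : (∏ j ∈ Finset.range (n + 1), (((n + 1 : ℕ) : ℝ) + s + 1 + j)) * (n + s + 1) =
      (∏ j ∈ Finset.range n, ((n : ℝ) + s + 1 + j)) * ((2 * n + s + 1) * (2 * n + s + 2)) := by
    have h1 := Finset.prod_range_succ' (fun j : ℕ => (n : ℝ) + s + 1 + j) (n + 1)
    rw [Finset.prod_range_succ, Finset.prod_range_succ] at h1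
    have h2 : ∀ j : ℕ, ((n + 1 : ℕ) : ℝ) + s + 1 + j = (n : ℝ) + s + 1 + ((j + 1 : ℕ) : ℝ) := by
      intro j; push_cast; ring
    simp only [h2]
    push_cast at h1 ⊢
    rw [add_zero] at h1
    rw [← h1]
    ring
  unfold scaledLeadingCoeff
  rw [ascPochhammer_eval_eq_prod, ascPochhammer_eval_eq_prod, Nat.factorial_succ]
  push_cast at key ⊢
  have h2s : (0 : ℝ) < 2 ^ s := by positivity
  have hfac : (0 : ℝ) < n.factorial := by positivity
  rw [div_mul_div_comm, div_eq_div_iff (by positivity) (by positivity), pow_succ]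
  linear_combination (4 * (n + 1) * (n.factorial : ℝ) * 4 ^ n * 2 ^ s) * key

theorem scaledLeadingCoeff_eq {s : ℝ} (hs : -2 < s) {n : ℕ} (hn : 1 ≤ n) :
    scaledLeadingCoeff s n = 4 * ((n + s + 1) * (n + s + 2) / ((2 * n + s + 1) * (2 * n + s + 2))) *
      (Real.GammaSeq (s + 2) n / Real.GammaSeq (s + 2) (2 * n)) *
      (((2 * n).factorial : ℝ) / ((n.factorial : ℝ) ^ 2 * 4 ^ n)) := by
  obtain ⟨m, rfl⟩ : ∃ m, n = m + 1 := ⟨n - 1, by omega⟩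
  set y := s + 2 with hy
  have hy0 : 0 < y := by linarith
  have hs' : s = y - 2 := by linarith
  have hm : (0 : ℝ) ≤ m := by positivity
  have hP : ∀ k : ℕ, 0 < ∏ j ∈ Finset.range k, (y + j) := fun k =>
    Finset.prod_pos fun j _ => by positivity
  have e1 : ∏ j ∈ Finset.range (m + 1 + 1), (y + (j : ℝ)) =
      (∏ j ∈ Finset.range m, (y + (j : ℝ))) * (y + m) * (y + (m + 1)) := by
    rw [Finset.prod_range_succ, Finset.prod_range_succ]; push_cast; ring
  have e2 : ∏ j ∈ Finset.range (2 * (m + 1) + 1), (y + (j : ℝ)) =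
      (∏ j ∈ Finset.range m, (y + (j : ℝ))) *
        (∏ j ∈ Finset.range (m + 1), (((m + 1 : ℕ) : ℝ) + s + 1 + j)) *
          (y + (2 * m + 1)) * (y + (2 * m + 2)) := by
    rw [show 2 * (m + 1) + 1 = (m + (m + 1)) + 1 + 1 by ring, Finset.prod_range_succ,
      Finset.prod_range_succ, Finset.prod_range_add]
    have : ∀ j : ℕ, ((m + 1 : ℕ) : ℝ) + s + 1 + j = y + ((m + j : ℕ) : ℝ) := by
      intro j; rw [hs']; push_cast; ring
    simp only [this]
    push_cast
    ring
  unfold scaledLeadingCoeff Real.GammaSeq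
  rw [ascPochhammer_eval_eq_prod, e1, e2]
  have hQ : 0 < ∏ j ∈ Finset.range (m + 1), (((m + 1 : ℕ) : ℝ) + s + 1 + j) := by
    refine Finset.prod_pos fun j _ => ?_
    have : (0 : ℝ) ≤ j := by positivity
    push_cast; linarith
  generalize (∏ j ∈ Finset.range (m + 1), (((m + 1 : ℕ) : ℝ) + s + 1 + j)) = Q at *
  have hPm := hP m
  generalize (∏ j ∈ Finset.range m, (y + (j : ℝ))) = P at *
  have h2y : (2 : ℝ) ^ y = 2 ^ s * 4 := by
    rw [hy, Real.rpow_add two_pos]; norm_num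
  push_cast
  rw [Real.mul_rpow two_pos.le (by positivity), h2y]
  have hmy : (0 : ℝ) < ((m : ℝ) + 1) ^ y := by positivity
  have h2s : (0 : ℝ) < 2 ^ s := by positivity
  have f1 : (0 : ℝ) < (m + 1).factorial := by positivity
  have f2 : (0 : ℝ) < (2 * (m + 1)).factorial := by positivity
  rw [hs'] at h2s ⊢
  have g1 : (m : ℝ) + 1 + (y - 2) + 1 = y + m := by ring
  have g2 : (m : ℝ) + 1 + (y - 2) + 2 = y + (m + 1) := by ring
  have g3 : 2 * ((m : ℝ) + 1) + (y - 2) + 1 = y + (2 * m + 1) := by ring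
  have g4 : 2 * ((m : ℝ) + 1) + (y - 2) + 2 = y + (2 * m + 2) := by ring
  rw [g1, g2, g3, g4]
  field_simp

theorem tendsto_affine_div_affine (a b c d : ℝ) (hc : c ≠ 0) :
    Filter.Tendsto (fun n : ℕ => (a * (n : ℝ) + b) / (c * n + d)) Filter.atTop (nhds (a / c)) := by
  have h1 : ∀ a b : ℝ, Filter.Tendsto (fun n : ℕ => a + b / (n : ℝ)) Filter.atTop (nhds a) := by
    intro a b
    simpa using (tendsto_const_div_atTop_nhds_zero_nat b).const_add a
  refine ((h1 a b).div (h1 c d) hc).congr' ?_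
  filter_upwards [Filter.eventually_gt_atTop 0] with n hn
  have : (n : ℝ) ≠ 0 := by positivity
  simp only [Pi.div_apply]
  rw [← mul_div_mul_right _ _ this]
  congr 1 <;> field_simp

theorem tendsto_scaledLeadingCoeff_sq {s : ℝ} (hs : -2 < s) :
    Filter.Tendsto (fun n : ℕ => π * ((n : ℝ) + (s + 1) / 2) * scaledLeadingCoeff s n ^ 2)
      Filter.atTop (nhds 1) := by
  have hG := Real.GammaSeq_tendsto_Gamma (s + 2)
  have hΓ : Real.Gamma (s + 2) ≠ 0 := (Real.Gamma_pos_of_pos (by linarith)).ne'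
  have h2 : Filter.Tendsto (fun n : ℕ => 2 * n) Filter.atTop Filter.atTop :=
    Filter.tendsto_atTop_mono (fun n => by simp; omega) Filter.tendsto_id
  have hGr := hG.div (hG.comp h2) hΓ
  have l1 := tendsto_affine_div_affine 1 (s + 1) 2 (s + 1) two_ne_zero
  have l2 := tendsto_affine_div_affine 1 (s + 2) 2 (s + 2) two_ne_zero
  have l3 := tendsto_affine_div_affine 1 ((s + 1) / 2) 2 1 two_ne_zero
  have hW := Real.Wallis.tendsto_W_nhds_pi_div_two
  have hπ := Real.pi_pos
  have := (((((l1.mul l2).const_mul 4).mul hGr).pow 2).mul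
    ((l3.const_mul π).div hW (by positivity)))
  have e : (4 * (1 / 2 * (1 / 2)) * (Real.Gamma (s + 2) / Real.Gamma (s + 2))) ^ 2 *
      (π * (1 / 2) / (π / 2)) = 1 := by
    field_simp; norm_num
  rw [e] at this
  refine this.congr' ?_
  filter_upwards [Filter.eventually_ge_atTop 1] with n hn
  simp only [Pi.div_apply, Function.comp_apply]
  rw [scaledLeadingCoeff_eq hs hn, Real.Wallis.W_eq_factorial_ratio]
  generalize Real.GammaSeq (s + 2) n / Real.GammaSeq (s + 2) (2 * n) = G
  have h16 : (2 : ℝ) ^ (4 * n) = (4 ^ n) ^ 2 := by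
    rw [← pow_mul, mul_comm n 2, pow_mul, pow_mul]
    norm_num
  rw [h16]
  have f1 : (0 : ℝ) < n.factorial := by positivity
  have f2 : (0 : ℝ) < (2 * n).factorial := by positivity
  have hn' : (1 : ℝ) ≤ n := by exact_mod_cast hn
  have g1 : 0 < 2 * (n : ℝ) + s + 1 := by linarith
  have g2 : 0 < 2 * (n : ℝ) + s + 2 := by linarith
  simp only [one_mul, ← add_assoc]
  field_simp

theorem exists_abs_scaledLeadingCoeff_sub_le {s : ℝ} (hs : -2 < s) :
    ∃ C : ℝ, ∀ᶠ n : ℕ in Filter.atTop,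
      |√(π * ((n : ℝ) + (s + 1) / 2)) * scaledLeadingCoeff s n - 1 -
        (1 / 8 - s ^ 2 / 4) / ((n : ℝ) + (s + 1) / 2)| ≤ C / ((n : ℝ) + (s + 1) / 2) ^ 2 := by
  obtain ⟨C, hC⟩ := exists_abs_sub_le_of_ratio (k := (s + 1) / 2) (σ := s ^ 2 / 4)
    (tendsto_scaledLeadingCoeff_sq hs) (by
      filter_upwards [Filter.eventually_ge_atTop 1] with n hn
      have hn' : (1 : ℝ) ≤ n := by exact_mod_cast hn
      have g1 : (n : ℝ) + s + 1 ≠ 0 := by linarith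
      have g2 : (n : ℝ) + 1 ≠ 0 := by linarith
      have g3 : ((n : ℝ) + (s + 1) / 2 + 1 / 2) ^ 2 - s ^ 2 / 4 = (n + s + 1) * (n + 1) := by ring
      rw [scaledLeadingCoeff_succ hs hn, g3]
      push_cast
      field_simp
      ring)
  obtain ⟨C', hC'⟩ := exists_abs_sqrt_sub_le (k := (s + 1) / 2) (c := 1 / 8 - s ^ 2 / 4) (C := C)
    (A := fun n : ℕ => π * ((n : ℝ) + (s + 1) / 2) * scaledLeadingCoeff s n ^ 2)
    (by
      filter_upwards [eventually_le_natCast_add 0 ((s + 1) / 2)] with n hn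
      have := Real.pi_pos
      positivity)
    (by
      refine hC.mono fun n h => ?_
      convert! h using 4
      ring)
  refine ⟨C', ?_⟩
  filter_upwards [hC', Filter.eventually_ge_atTop 1] with n h hn
  rwa [Real.sqrt_mul' _ (sq_nonneg _), Real.sqrt_sq (scaledLeadingCoeff_pos hs hn).le] at h

theorem norm_sub_le_of_norm_deriv_le_exp {f f' : ℝ → ℂ} {C : ℝ} {L : ℂ}
    (hf : ∀ t, 0 ≤ t → HasDerivAt f (f' t) t) (hC : ∀ t, 0 ≤ t → ‖f' t‖ ≤ C * Real.exp (-t))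
    (hL : Filter.Tendsto f Filter.atTop (nhds L)) {t : ℝ} (ht : 0 ≤ t) : ‖f t - L‖ ≤ C := by
  have hC0 : 0 ≤ C := by simpa using (norm_nonneg _).trans (hC 0 le_rfl)
  have key : ∀ T, t ≤ T → ‖f T - f t‖ ≤ C := by
    intro T hT
    have h := image_norm_le_of_norm_deriv_right_le_deriv_boundary (f := fun x => f x - f t)
      (f' := f') (a := t) (b := T) (B := fun x => C * (Real.exp (-t) - Real.exp (-x)))
      (B' := fun x => C * Real.exp (-x))
      (fun x hx => ((hf x (ht.trans hx.1)).sub_const _).continuousAt.continuousWithinAt)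
      (fun x hx => ((hf x (ht.trans hx.1)).sub_const _).hasDerivWithinAt)
      (by simp)
      (fun x => by
        simpa using (((hasDerivAt_neg x).exp).const_sub (Real.exp (-t))).const_mul C)
      (fun x hx => hC x (ht.trans hx.1)) (Set.right_mem_Icc.2 hT)
    refine h.trans ?_
    have h1 : Real.exp (-t) ≤ 1 := Real.exp_le_one_iff.2 (by linarith)
    have h2 := Real.exp_pos (-T)
    nlinarith
  have hlim : Filter.Tendsto (fun T => ‖f T - f t‖) Filter.atTop (nhds ‖L - f t‖) :=
    (hL.sub_const _).norm
  rw [norm_sub_rev]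
  exact le_of_tendsto hlim (Filter.eventually_atTop.2 ⟨t, key⟩)

theorem norm_le_of_norm_deriv_add_mul_le {f f' : ℝ → ℂ} {c C : ℝ} (hc : 0 < c)
    (hf : ∀ t, 0 ≤ t → HasDerivAt f (f' t) t) (hC : ∀ t, 0 ≤ t → ‖f' t + c * f t‖ ≤ C)
    {t : ℝ} (ht : 0 ≤ t) : ‖f t‖ ≤ ‖f 0‖ + C / c := by
  have hC0 : 0 ≤ C := (norm_nonneg _).trans (hC 0 le_rfl)
  have hE : ∀ x : ℝ, HasDerivAt (fun x : ℝ => Real.exp (c * x)) (Real.exp (c * x) * c) x := by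
    intro x
    simpa using ((hasDerivAt_id x).const_mul c).exp
  have hd : ∀ x, 0 ≤ x → HasDerivAt (fun x => (Real.exp (c * x) : ℂ) * f x)
      ((Real.exp (c * x) : ℂ) * (f' x + c * f x)) x := by
    intro x hx
    convert! (hE x).ofReal_comp.mul (hf x hx) using 1
    push_cast
    ring
  have h := image_norm_le_of_norm_deriv_right_le_deriv_boundary
    (f := fun x => (Real.exp (c * x) : ℂ) * f x)
    (f' := fun x => (Real.exp (c * x) : ℂ) * (f' x + c * f x)) (a := 0) (b := t)
    (B := fun x => ‖f 0‖ + C / c * (Real.exp (c * x) - 1))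
    (B' := fun x => C * Real.exp (c * x))
    (fun x hx => (hd x hx.1).continuousAt.continuousWithinAt)
    (fun x hx => (hd x hx.1).hasDerivWithinAt)
    (by simp)
    (fun x => by
      convert! (((hE x).sub_const 1).const_mul (C / c)).const_add ‖f 0‖ using 1
      field_simp)
    (fun x hx => by
      rw [norm_mul, Complex.norm_real, Real.norm_of_nonneg (Real.exp_pos _).le, mul_comm C]
      exact mul_le_mul_of_nonneg_left (hC x hx.1) (Real.exp_pos _).le)
    (Set.right_mem_Icc.2 ht)
  simp only [norm_mul, Complex.norm_real, Real.norm_of_nonneg (Real.exp_pos _).le] at h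
  have hexp : 1 ≤ Real.exp (c * t) := Real.one_le_exp (by positivity)
  have h1 : Real.exp (c * t) * ‖f t‖ ≤ Real.exp (c * t) * (‖f 0‖ + C / c) := by
    refine h.trans ?_
    have : 0 ≤ C / c := by positivity
    nlinarith [norm_nonneg (f 0)]
  exact le_of_mul_le_mul_left h1 (by positivity)

theorem exists_norm_le_of_tendsto {f : ℝ → ℂ} {L : ℂ} (hf : ∀ t, 0 ≤ t → ContinuousAt f t)
    (hL : Filter.Tendsto f Filter.atTop (nhds L)) : ∃ M, ∀ t, 0 ≤ t → ‖f t‖ ≤ M := by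
  have h1 : ∀ᶠ t in Filter.atTop, ‖f t‖ ≤ ‖L‖ + 1 :=
    hL.norm.eventually_le_const (by linarith)
  obtain ⟨T, hT⟩ := Filter.eventually_atTop.1 h1
  obtain ⟨M, hM⟩ := (isCompact_Icc (a := (0 : ℝ)) (b := T)).exists_bound_of_continuousOn
    (f := f) (fun t ht => (hf t ht.1).continuousWithinAt)
  refine ⟨max M (‖L‖ + 1), fun t ht => ?_⟩
  rcases le_total t T with h | h
  · exact (hM t ⟨ht, h⟩).trans (le_max_left _ _)
  · exact (hT t h).trans (le_max_right _ _)

/-- A priori bounds for the solution of `D² h + 2 κ D h = q h` which tends to `L` at infinity and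
satisfies a reality condition at `0`. -/
theorem norm_le_and_norm_deriv_le {h h₁ q : ℝ → ℂ} {κ B L U v : ℝ} {e : ℂ}
    (he : ‖e‖ = 1) (hL0 : 0 ≤ L) (hκ : 1 ≤ κ) (hκB : 3 * B ≤ κ)
    (hh : ∀ t, 0 ≤ t → HasDerivAt h (h₁ t) t)
    (hh₁ : ∀ t, 0 ≤ t → HasDerivAt h₁ (q t * h t - 2 * κ * h₁ t) t)
    (bq : ∀ t, 0 ≤ t → ‖q t‖ ≤ B * Real.exp (-t))
    (hL : Filter.Tendsto h Filter.atTop (nhds L))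
    (hL₁ : Filter.Tendsto h₁ Filter.atTop (nhds 0))
    (h0 : h 0 = e * U) (h10 : h₁ 0 + κ * h 0 = e * (v * Complex.I)) :
    ∀ t, 0 ≤ t → ‖h t‖ ≤ 8 * L ∧ ‖h₁ t‖ ≤ 21 * κ * L ∧ ‖h₁ t + 2 * κ * h t‖ ≤ 5 * κ * L := by
  have hκ0 : 0 < κ := by linarith
  have hB : 0 ≤ B := by simpa using (norm_nonneg _).trans (bq 0 le_rfl)
  obtain ⟨M₀, hM₀⟩ := exists_norm_le_of_tendsto (fun t ht => (hh t ht).continuousAt) hL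
  set M := ⨆ t : Set.Ici (0 : ℝ), ‖h t‖ with hM
  have hbdd : BddAbove (Set.range fun t : Set.Ici (0 : ℝ) => ‖h t‖) :=
    ⟨M₀, by rintro _ ⟨t, rfl⟩; exact hM₀ t t.2⟩
  have hMle : ∀ t, 0 ≤ t → ‖h t‖ ≤ M := fun t ht => le_ciSup hbdd (⟨t, ht⟩ : Set.Ici (0 : ℝ))
  have hM0 : 0 ≤ M := (norm_nonneg _).trans (hMle 0 le_rfl)
  have hN : ∀ t, 0 ≤ t → ‖h₁ t + 2 * κ * h t - 2 * κ * L‖ ≤ B * M := by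
    intro t ht
    refine norm_sub_le_of_norm_deriv_le_exp (f := fun t => h₁ t + 2 * κ * h t)
      (f' := fun t => q t * h t) ?_ ?_ ?_ ht
    · intro t ht
      convert! (hh₁ t ht).add ((hh t ht).const_mul (2 * κ : ℂ)) using 1
      ring
    · intro t ht
      rw [norm_mul, mul_right_comm]
      exact mul_le_mul (bq t ht) (hMle t ht) (norm_nonneg _) (by positivity)
    · simpa using hL₁.add (hL.const_mul (2 * κ : ℂ))
  have hN' : ∀ t, 0 ≤ t → ‖h₁ t + 2 * κ * h t‖ ≤ 2 * κ * L + B * M := by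
    intro t ht
    have h1 := norm_le_norm_add_norm_sub' (h₁ t + 2 * κ * h t) (2 * κ * L : ℂ)
    have h2 : ‖(2 * κ * L : ℂ)‖ = 2 * κ * L := by
      simp [abs_of_pos hκ0, abs_of_nonneg hL0]
    rw [h2] at h1
    linarith [hN t ht]
  have hU : |U| ≤ 2 * L + B * M / κ := by
    have h1 := hN' 0 le_rfl
    have h2 : h₁ 0 + 2 * κ * h 0 = e * ((κ * U : ℝ) + v * Complex.I) := by
      push_cast
      linear_combination h10 + κ * h0
    rw [h2, norm_mul, he, one_mul] at h1
    have h3 := (Complex.abs_re_le_norm ((κ * U : ℝ) + v * Complex.I)).trans h1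
    simp only [Complex.add_re, Complex.ofReal_re, Complex.mul_re, Complex.I_re, mul_zero,
      Complex.ofReal_im, Complex.I_im, mul_one, sub_self, add_zero, abs_mul, abs_of_pos hκ0] at h3
    rw [← sub_nonneg] at h3 ⊢
    have : 2 * L + B * M / κ - |U| = (2 * κ * L + B * M - κ * |U|) / κ := by field_simp
    rw [this]
    positivity
  have hh0 : ‖h 0‖ = |U| := by rw [h0, norm_mul, he, one_mul, Complex.norm_real, Real.norm_eq_abs]
  have hsup : ∀ t, 0 ≤ t → ‖h t‖ ≤ 4 * L + M / 2 := by
    intro t ht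
    have h1 := norm_le_of_norm_deriv_add_mul_le (f := fun t => h t - L) (f' := h₁) (c := 2 * κ)
      (C := B * M) (by positivity) (fun t ht => (hh t ht).sub_const _)
      (fun t ht => by convert hN t ht using 2; push_cast; ring) ht
    have hLn : ‖(L : ℂ)‖ = L := by simp [abs_of_nonneg hL0]
    have h2 := norm_le_norm_add_norm_sub' (h t) (L : ℂ)
    have h3 := norm_sub_le (h 0) (L : ℂ)
    rw [hLn] at h2 h3
    rw [hh0] at h3
    have h4 : B * M / κ ≤ M / 3 := by
      rw [div_le_div_iff₀ hκ0 (by norm_num)]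
      nlinarith
    have h5 : B * M / (2 * κ) = B * M / κ / 2 := by field_simp
    linarith
  have hM8 : M ≤ 8 * L := by
    have : M ≤ 4 * L + M / 2 := ciSup_le fun t => hsup t t.2
    linarith
  intro t ht
  have hBM : B * M ≤ 8 / 3 * (κ * L) := by nlinarith
  have hn := hN' t ht
  have hht := (hMle t ht).trans hM8
  refine ⟨hht, ?_, by nlinarith⟩
  have h1 := norm_sub_le (h₁ t + 2 * κ * h t) (2 * κ * h t)
  rw [add_sub_cancel_right] at h1
  have h2 : ‖2 * κ * h t‖ = 2 * κ * ‖h t‖ := by simp [abs_of_pos hκ0]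
  rw [h2] at h1
  have h3 : κ * ‖h t‖ ≤ κ * (8 * L) := mul_le_mul_of_nonneg_left hht hκ0.le
  nlinarith

/-- Second order value at `0` of the solution of `D² h + 2 κ D h = q h` which tends to `L` at
infinity and satisfies a reality condition at `0`. -/
theorem abs_sub_le_of_hasDerivAt {h h₁ q q₁ Q : ℝ → ℂ} {κ B L U v : ℝ} {e : ℂ}
    (he : ‖e‖ = 1) (hL0 : 0 ≤ L) (hκ : 1 ≤ κ) (hκB : 3 * B ≤ κ)
    (hh : ∀ t, 0 ≤ t → HasDerivAt h (h₁ t) t)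
    (hh₁ : ∀ t, 0 ≤ t → HasDerivAt h₁ (q t * h t - 2 * κ * h₁ t) t)
    (hQ : ∀ t, 0 ≤ t → HasDerivAt Q (q t) t) (hq : ∀ t, 0 ≤ t → HasDerivAt q (q₁ t) t)
    (bQ : ∀ t, 0 ≤ t → ‖Q t‖ ≤ B * Real.exp (-t))
    (bq : ∀ t, 0 ≤ t → ‖q t‖ ≤ B * Real.exp (-t))
    (bq₁ : ∀ t, 0 ≤ t → ‖q₁ t‖ ≤ B * Real.exp (-t))
    (hL : Filter.Tendsto h Filter.atTop (nhds L))
    (hL₁ : Filter.Tendsto h₁ Filter.atTop (nhds 0))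
    (h0 : h 0 = e * U) (h10 : h₁ 0 + κ * h 0 = e * (v * Complex.I)) :
    |U - 2 * L * (starRingEnd ℂ e * (1 + Q 0 / (2 * κ))).re| ≤
      (14 * B + 9 * B ^ 2) * L / κ ^ 2 := by
  have hκ0 : 0 < κ := by linarith
  have hκC : (κ : ℂ) ≠ 0 := by exact_mod_cast hκ0.ne'
  have hB : 0 ≤ B := by simpa using (norm_nonneg _).trans (bq 0 le_rfl)
  have apr := norm_le_and_norm_deriv_le he hL0 hκ hκB hh hh₁ bq hL hL₁ h0 h10
  have hdecay : ∀ {f : ℝ → ℂ}, (∀ t, 0 ≤ t → ‖f t‖ ≤ B * Real.exp (-t)) →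
      Filter.Tendsto f Filter.atTop (nhds 0) := by
    intro f hf
    refine squeeze_zero_norm' (Filter.eventually_atTop.2 ⟨0, hf⟩) ?_
    simpa using (Real.tendsto_exp_neg_atTop_nhds_zero).const_mul B
  have hΦ : ‖(h₁ 0 + 2 * κ * h 0 - Q 0 * h 0 - Q 0 * h₁ 0 / (2 * κ) - q 0 * h₁ 0 / (4 * κ ^ 2)) -
      2 * κ * L‖ ≤ (6 * B + 6 * B ^ 2) * L / κ := by
    refine norm_sub_le_of_norm_deriv_le_exp (t := 0)
      (f := fun t => h₁ t + 2 * κ * h t - Q t * h t - Q t * h₁ t / (2 * κ) -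
        q t * h₁ t / (4 * κ ^ 2))
      (f' := fun t => -((q₁ t * h₁ t + q t * q t * h t) / (4 * κ ^ 2) +
        Q t * q t * h t / (2 * κ))) ?_ ?_ ?_ le_rfl
    · intro t ht
      have d1 := hh t ht
      have d2 := hh₁ t ht
      convert! ((((d2.add (d1.const_mul (2 * κ : ℂ))).sub ((hQ t ht).mul d1)).sub
        (((hQ t ht).mul d2).div_const (2 * κ))).sub (((hq t ht).mul d2).div_const (4 * κ ^ 2)))
        using 1
      field_simp
      ring
    · intro t ht
      obtain ⟨a1, a2, -⟩ := apr t ht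
      have hexp : Real.exp (-t) ≤ 1 := Real.exp_le_one_iff.2 (by linarith)
      have hexp0 := Real.exp_pos (-t)
      have b1 : ‖q t‖ ≤ B := (bq t ht).trans (by nlinarith)
      have b2 : ‖q t * q t * h t‖ ≤ B * Real.exp (-t) * B * (8 * L) := by
        rw [norm_mul, norm_mul]
        gcongr
        exact bq t ht
      have b3 : ‖Q t * q t * h t‖ ≤ B * Real.exp (-t) * B * (8 * L) := by
        rw [norm_mul, norm_mul]
        gcongr
        exact bQ t ht
      have b4 : ‖q₁ t * h₁ t‖ ≤ B * Real.exp (-t) * (21 * κ * L) := by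
        rw [norm_mul]
        gcongr
        exact bq₁ t ht
      have n1 : ‖(4 * κ ^ 2 : ℂ)‖ = 4 * κ ^ 2 := by simp
      have n2 : ‖(2 * κ : ℂ)‖ = 2 * κ := by simp [abs_of_pos hκ0]
      rw [norm_neg]
      refine (norm_add_le _ _).trans ?_
      rw [norm_div, norm_div, n1, n2]
      have c1 := (norm_add_le (q₁ t * h₁ t) (q t * q t * h t)).trans (add_le_add b4 b2)
      calc _ ≤ (B * Real.exp (-t) * (21 * κ * L) + B * Real.exp (-t) * B * (8 * L)) / (4 * κ ^ 2) +
            B * Real.exp (-t) * B * (8 * L) / (2 * κ) := by gcongr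
        _ = (21 / 4 * B + 2 * B ^ 2 / κ + 4 * B ^ 2) * L / κ * Real.exp (-t) := by
            field_simp; ring
        _ ≤ (6 * B + 6 * B ^ 2) * L / κ * Real.exp (-t) := by
            have : 2 * B ^ 2 / κ ≤ 2 * B ^ 2 := div_le_self (by positivity) hκ
            gcongr ?_ * L / κ * Real.exp (-t)
            linarith
    · have t1 := hdecay bQ
      have t2 := hdecay bq
      have := ((((hL₁.add (hL.const_mul (2 * κ : ℂ))).sub (t1.mul hL)).sub
        ((t1.mul hL₁).div_const (2 * κ))).sub ((t2.mul hL₁).div_const (4 * κ ^ 2)))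
      simpa using this
  obtain ⟨-, a2, a3⟩ := apr 0 le_rfl
  have bQ0 : ‖Q 0‖ ≤ B := by simpa using bQ 0 le_rfl
  have bq0 : ‖q 0‖ ≤ B := by simpa using bq 0 le_rfl
  set N := h₁ 0 + 2 * κ * h 0 with hN
  have bz : ‖Q 0 / (2 * κ)‖ ≤ B / (2 * κ) := by
    rw [norm_div]
    have n2 : ‖(2 * κ : ℂ)‖ = 2 * κ := by simp [abs_of_pos hκ0]
    rw [n2]
    gcongr
  have e1 : N - 2 * κ * L * (1 + Q 0 / (2 * κ)) =
      (1 + Q 0 / (2 * κ)) * (((N - Q 0 * h 0 - Q 0 * h₁ 0 / (2 * κ) - q 0 * h₁ 0 / (4 * κ ^ 2)) -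
        2 * κ * L) + q 0 * h₁ 0 / (4 * κ ^ 2)) + (Q 0 / (2 * κ)) * (Q 0 / (2 * κ)) * N := by
    rw [hN]
    field_simp
    ring
  set z := Q 0 / (2 * κ) with hz
  have b1z : ‖1 + z‖ ≤ 7 / 6 := by
    refine (norm_add_le _ _).trans ?_
    rw [norm_one]
    have : B / (2 * κ) ≤ 1 / 6 := by
      rw [div_le_div_iff₀ (by positivity) (by norm_num)]
      linarith
    linarith
  have bN : ‖N - 2 * κ * L * (1 + z)‖ ≤ (14 * B + 9 * B ^ 2) * L / κ := by
    rw [e1]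
    have c1 : ‖q 0 * h₁ 0 / (4 * κ ^ 2)‖ ≤ B * (21 * κ * L) / (4 * κ ^ 2) := by
      rw [norm_div, norm_mul]
      have n1 : ‖(4 * κ ^ 2 : ℂ)‖ = 4 * κ ^ 2 := by simp
      rw [n1]
      gcongr
    have c2 := norm_add_le (N - Q 0 * h 0 - Q 0 * h₁ 0 / (2 * κ) - q 0 * h₁ 0 / (4 * κ ^ 2) -
      2 * κ * L) (q 0 * h₁ 0 / (4 * κ ^ 2))
    calc _ ≤ 7 / 6 * ((6 * B + 6 * B ^ 2) * L / κ + B * (21 * κ * L) / (4 * κ ^ 2)) +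
          B / (2 * κ) * (B / (2 * κ)) * (5 * κ * L) := by
          refine (norm_add_le _ _).trans ?_
          rw [norm_mul, norm_mul, norm_mul]
          gcongr
          linarith
      _ = (7 / 6 * (6 + 21 / 4) * B + (7 + 5 / 4) * B ^ 2) * L / κ := by field_simp; ring
      _ ≤ _ := by gcongr <;> norm_num
  have hre : (starRingEnd ℂ e * (N - 2 * κ * L * (1 + z))).re =
      κ * (U - 2 * L * (starRingEnd ℂ e * (1 + z)).re) := by
    have h2 : N = e * ((κ * U : ℝ) + v * Complex.I) := by
      push_cast
      linear_combination h10 + κ * h0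
    have h3 : starRingEnd ℂ e * e = 1 := by
      rw [mul_comm, Complex.mul_conj, Complex.normSq_eq_norm_sq, he]; norm_num
    have h4 : starRingEnd ℂ e * (N - 2 * κ * L * (1 + z)) =
        ((κ * U : ℝ) + v * Complex.I) - ((2 * κ * L : ℝ) : ℂ) * (starRingEnd ℂ e * (1 + z)) := by
      rw [h2]
      push_cast
      linear_combination (κ * U + v * Complex.I : ℂ) * h3
    rw [h4, Complex.sub_re, Complex.re_ofReal_mul]
    simp
    ring
  have hfin := Complex.abs_re_le_norm (starRingEnd ℂ e * (N - 2 * κ * L * (1 + z)))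
  rw [hre, norm_mul, RCLike.norm_conj, he, one_mul, abs_mul, abs_of_pos hκ0] at hfin
  have h5 := hfin.trans bN
  rw [show (14 * B + 9 * B ^ 2) * L / κ ^ 2 = (14 * B + 9 * B ^ 2) * L / κ / κ by field_simp,
    le_div_iff₀ hκ0]
  linarith

/-- The coefficients of the Jacobi polynomial in powers of `(x - 1) / 2`. -/
noncomputable def jacobiCoeff (α β : ℝ) (n ℓ : ℕ) : ℝ :=
  ((ascPochhammer ℝ ℓ).eval ((n : ℝ) + α + β + 1) *
      (ascPochhammer ℝ (n - ℓ)).eval (α + (ℓ : ℝ) + 1)) /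
    ((Nat.factorial ℓ : ℝ) * (Nat.factorial (n - ℓ) : ℝ))

/-- The Jacobi polynomial as a polynomial in the variable `(x - 1) / 2`. -/
noncomputable def jacobiPoly (α β : ℝ) (n : ℕ) : Polynomial ℝ :=
  ∑ ℓ ∈ Finset.range (n + 1), Polynomial.C (jacobiCoeff α β n ℓ) * Polynomial.X ^ ℓ

theorem jacobiP_eq_eval (α β : ℝ) (n : ℕ) (x : ℝ) :
    jacobiP α β n x = (jacobiPoly α β n).eval ((x - 1) / 2) := by
  simp [jacobiP, jacobiPoly, jacobiCoeff, Polynomial.eval_finsetSum]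

theorem jacobiPoly_coeff (α β : ℝ) (n k : ℕ) :
    (jacobiPoly α β n).coeff k = if k ≤ n then jacobiCoeff α β n k else 0 := by
  simp [jacobiPoly, Polynomial.coeff_X_pow]

theorem jacobiCoeff_succ {α : ℝ} (β : ℝ) {n k : ℕ} (hk : k < n) :
    ((k : ℝ) + 1) * (k + 1 + α) * jacobiCoeff α β n (k + 1) =
      ((n : ℝ) - k) * (n + k + α + β + 1) * jacobiCoeff α β n k := by
  obtain ⟨m, rfl⟩ : ∃ m, n = k + 1 + m := ⟨n - (k + 1), by omega⟩
  unfold jacobiCoeff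
  have h1 : k + 1 + m - (k + 1) = m := by omega
  have h2 : k + 1 + m - k = m + 1 := by omega
  have h3 : (ascPochhammer ℝ (m + 1)).eval (α + (k : ℝ) + 1) =
      (α + k + 1) * (ascPochhammer ℝ m).eval (α + ((k + 1 : ℕ) : ℝ) + 1) := by
    rw [ascPochhammer_eval_eq_prod, ascPochhammer_eval_eq_prod, Finset.prod_range_succ', mul_comm]
    congr 1
    · simp
    · refine Finset.prod_congr rfl fun j _ => ?_
      push_cast
      ring
  rw [h1, h2, h3, ascPochhammer_succ_eval, Nat.factorial_succ, Nat.factorial_succ]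
  have f1 : (k.factorial : ℝ) ≠ 0 := by positivity
  have f2 : (m.factorial : ℝ) ≠ 0 := by positivity
  have f3 : (k : ℝ) + 1 ≠ 0 := by positivity
  have f4 : (m : ℝ) + 1 ≠ 0 := by positivity
  push_cast
  field_simp
  ring

theorem jacobiPoly_coeff_succ (α β : ℝ) (n k : ℕ) :
    ((k : ℝ) + 1) * (k + 1 + α) * (jacobiPoly α β n).coeff (k + 1) =
      ((n : ℝ) - k) * (n + k + α + β + 1) * (jacobiPoly α β n).coeff k := by
  rw [jacobiPoly_coeff, jacobiPoly_coeff]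
  rcases lt_trichotomy k n with h | h | h
  · rw [if_pos (by omega), if_pos (by omega), jacobiCoeff_succ β h]
  · subst h; simp
  · rw [if_neg (by omega), if_neg (by omega)]; simp

theorem coeff_X_mul_derivative (p : Polynomial ℝ) (k : ℕ) :
    (Polynomial.X * p.derivative).coeff k = k * p.coeff k := by
  cases k with
  | zero => simp
  | succ k => rw [Polynomial.coeff_X_mul, Polynomial.coeff_derivative]; push_cast; ring

/-- The differential equation of the Jacobi polynomials. -/
theorem jacobiPoly_differential_equation (α β : ℝ) (n : ℕ) :
    Polynomial.X * (1 + Polynomial.X) * (jacobiPoly α β n).derivative.derivative +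
      (Polynomial.C (α + 1) + Polynomial.C (α + β + 2) * Polynomial.X) *
        (jacobiPoly α β n).derivative =
      Polynomial.C ((n : ℝ) * (n + α + β + 1)) * jacobiPoly α β n := by
  set p := jacobiPoly α β n with hp
  have e : Polynomial.X * (1 + Polynomial.X) * p.derivative.derivative +
      (Polynomial.C (α + 1) + Polynomial.C (α + β + 2) * Polynomial.X) * p.derivative =
      ((Polynomial.X * p.derivative).derivative - p.derivative) +
      (Polynomial.X * (Polynomial.X * p.derivative).derivative - Polynomial.X * p.derivative) +
      Polynomial.C (α + 1) * p.derivative +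
      Polynomial.C (α + β + 2) * (Polynomial.X * p.derivative) := by
    simp only [Polynomial.derivative_mul, Polynomial.derivative_X]
    ring
  rw [e]
  ext k
  simp only [Polynomial.coeff_add, Polynomial.coeff_sub, Polynomial.coeff_C_mul,
    Polynomial.coeff_derivative, coeff_X_mul_derivative]
  have := jacobiPoly_coeff_succ α β n k
  rw [← hp] at this
  push_cast
  linear_combination this

theorem aeval_jacobiPoly_differential_equation (α β : ℝ) (n : ℕ) (y : ℂ) :
    y * (1 + y) * Polynomial.aeval y (jacobiPoly α β n).derivative.derivative +
      ((α + 1) + (α + β + 2) * y) * Polynomial.aeval y (jacobiPoly α β n).derivative =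
      n * (n + α + β + 1) * Polynomial.aeval y (jacobiPoly α β n) := by
  simpa using congrArg (Polynomial.aeval y) (jacobiPoly_differential_equation α β n)

/-- The polynomial `w ^ n * P_n((w + 1 / w) / 2)` in the variable `w`. -/
noncomputable def reciprocalJacobi (α β : ℝ) (n : ℕ) : Polynomial ℂ :=
  ∑ ℓ ∈ Finset.range (n + 1), Polynomial.C (jacobiCoeff α β n ℓ : ℂ) * Polynomial.X ^ (n - ℓ) *
    (Polynomial.C (1 / 4) * (1 - Polynomial.X) ^ 2) ^ ℓ

theorem reciprocalJacobi_eval (α β : ℝ) (n : ℕ) {w : ℂ} (hw : w ≠ 0) :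
    (reciprocalJacobi α β n).eval w =
      w ^ n * Polynomial.aeval ((1 - w) ^ 2 / (4 * w)) (jacobiPoly α β n) := by
  simp only [reciprocalJacobi, jacobiPoly, Polynomial.eval_finsetSum, map_sum, Finset.mul_sum]
  refine Finset.sum_congr rfl fun ℓ hℓ => ?_
  have hℓn : ℓ ≤ n := Nat.lt_succ_iff.1 (Finset.mem_range.1 hℓ)
  simp only [Polynomial.eval_mul, Polynomial.eval_pow, Polynomial.eval_C, Polynomial.eval_X,
    Polynomial.eval_sub, Polynomial.eval_one, map_mul, map_pow, Polynomial.aeval_C,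
    Polynomial.aeval_X, Complex.coe_algebraMap]
  rw [show w ^ n = w ^ (n - ℓ) * w ^ ℓ by rw [← pow_add, Nat.sub_add_cancel hℓn]]
  have h : (1 / 4 * (1 - w) ^ 2) ^ ℓ = w ^ ℓ * ((1 - w) ^ 2 / (4 * w)) ^ ℓ := by
    rw [← mul_pow]
    congr 1
    field_simp
  rw [h]
  ring

theorem reciprocalJacobi_eval_zero (α β : ℝ) (n : ℕ) :
    (reciprocalJacobi α β n).eval 0 = ((jacobiCoeff α β n n / 4 ^ n : ℝ) : ℂ) := by
  simp only [reciprocalJacobi, Polynomial.eval_finsetSum]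
  rw [Finset.sum_eq_single n]
  · simp [div_eq_mul_inv]
  · intro ℓ hℓ hne
    have : n - ℓ ≠ 0 := by
      have := Finset.mem_range.1 hℓ
      omega
    simp [this]
  · simp

theorem hasDerivAt_pow_of_ne_zero (n : ℕ) {w : ℂ} (hw : w ≠ 0) :
    HasDerivAt (fun w : ℂ => w ^ n) (n * w ^ n / w) w := by
  refine (hasDerivAt_pow n w).congr_deriv ?_
  cases n with
  | zero => simp
  | succ n => rw [pow_succ]; field_simp; simp

theorem hasDerivAt_aeval_joukowski (p : Polynomial ℝ) {w : ℂ} (hw : w ≠ 0) :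
    HasDerivAt (fun w : ℂ => Polynomial.aeval ((1 - w) ^ 2 / (4 * w)) p)
      (Polynomial.aeval ((1 - w) ^ 2 / (4 * w)) p.derivative * ((w ^ 2 - 1) / (4 * w ^ 2))) w := by
  have h1 : HasDerivAt (fun w : ℂ => (1 - w) ^ 2 / (4 * w)) ((w ^ 2 - 1) / (4 * w ^ 2)) w := by
    have := (((hasDerivAt_id w).const_sub 1).pow 2).div ((hasDerivAt_id w).const_mul 4)
      (by simpa using hw)
    convert! this using 1
    simp
    field_simp
    ring
  exact (p.hasDerivAt_aeval _).comp w h1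

theorem reciprocalJacobi_derivative_eval (α β : ℝ) (n : ℕ) {w : ℂ} (hw : w ≠ 0) :
    (reciprocalJacobi α β n).derivative.eval w =
      n * w ^ n / w * Polynomial.aeval ((1 - w) ^ 2 / (4 * w)) (jacobiPoly α β n) +
      w ^ n * (Polynomial.aeval ((1 - w) ^ 2 / (4 * w)) (jacobiPoly α β n).derivative *
        ((w ^ 2 - 1) / (4 * w ^ 2))) := by
  refine ((reciprocalJacobi α β n).hasDerivAt w).unique ?_
  refine ((hasDerivAt_pow_of_ne_zero n hw).mul
    (hasDerivAt_aeval_joukowski (jacobiPoly α β n) hw)).congr_of_eventuallyEq ?_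
  filter_upwards [isOpen_ne.mem_nhds hw] with z hz
  exact reciprocalJacobi_eval α β n hz

theorem reciprocalJacobi_derivative_derivative_eval (α β : ℝ) (n : ℕ) {w : ℂ} (hw : w ≠ 0) :
    (reciprocalJacobi α β n).derivative.derivative.eval w =
      w ^ n * (n * (n - 1) / w ^ 2 *
          Polynomial.aeval ((1 - w) ^ 2 / (4 * w)) (jacobiPoly α β n) +
        (2 * n / w * ((w ^ 2 - 1) / (4 * w ^ 2)) + 1 / (2 * w ^ 3)) *
          Polynomial.aeval ((1 - w) ^ 2 / (4 * w)) (jacobiPoly α β n).derivative +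
        ((w ^ 2 - 1) / (4 * w ^ 2)) ^ 2 *
          Polynomial.aeval ((1 - w) ^ 2 / (4 * w)) (jacobiPoly α β n).derivative.derivative) := by
  refine ((reciprocalJacobi α β n).derivative.hasDerivAt w).unique ?_
  have hn := hasDerivAt_pow_of_ne_zero n hw
  have h1 : HasDerivAt (fun w : ℂ => (w ^ 2 - 1) / (4 * w ^ 2)) (1 / (2 * w ^ 3)) w := by
    have := (((hasDerivAt_id w).pow 2).sub_const 1).div (((hasDerivAt_id w).pow 2).const_mul 4)
      (by simpa using hw)
    convert! this using 1
    simp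
    field_simp
    ring
  have h2 := ((((hn.const_mul (n : ℂ)).div (hasDerivAt_id w) hw).mul
    (hasDerivAt_aeval_joukowski (jacobiPoly α β n) hw)).add
      (hn.mul ((hasDerivAt_aeval_joukowski (jacobiPoly α β n).derivative hw).mul h1)))
  refine (h2.congr_of_eventuallyEq ?_).congr_deriv ?_
  · filter_upwards [isOpen_ne.mem_nhds hw] with z hz
    exact reciprocalJacobi_derivative_eval α β n hz
  · simp only [Pi.div_apply, Pi.mul_apply, id]
    generalize Polynomial.aeval ((1 - w) ^ 2 / (4 * w))
      (jacobiPoly α β n).derivative.derivative = P₂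
    generalize Polynomial.aeval ((1 - w) ^ 2 / (4 * w)) (jacobiPoly α β n).derivative = P₁
    generalize Polynomial.aeval ((1 - w) ^ 2 / (4 * w)) (jacobiPoly α β n) = P₀
    generalize w ^ n = W
    field_simp
    ring

/-- The differential equation for `(1 - w) ^ a * (1 + w) ^ b * reciprocalJacobi α β n` in
the variable `t` with `w = e ^ (i θ - t)`, written in terms of the logarithmic derivative
of the algebraic factor. -/
theorem reciprocalJacobi_differential_equation (α β : ℝ) (n : ℕ) {w : ℂ} (hw : w ≠ 0)
    (hw1 : 1 - w ≠ 0) (hw2 : 1 + w ≠ 0) :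
    let g := (reciprocalJacobi α β n).eval w
    let g₁ := (reciprocalJacobi α β n).derivative.eval w
    let g₂ := (reciprocalJacobi α β n).derivative.derivative.eval w
    let μ : ℂ := (α + 1 / 2) * (w / (1 - w)) - (β + 1 / 2) * (w / (1 + w))
    let μ₁ : ℂ := -(α + 1 / 2) * (w / (1 - w) ^ 2) + (β + 1 / 2) * (w / (1 + w) ^ 2)
    μ * (μ * g - w * g₁) + (μ₁ * g - μ * (w * g₁) + w * g₁ + w ^ 2 * g₂) =
      (-(1 / 4 - α ^ 2) * (w / (1 - w) ^ 2) + (1 / 4 - β ^ 2) * (w / (1 + w) ^ 2)) * g -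
        2 * (n + (α + β + 1) / 2) * (μ * g - w * g₁) := by
  intro g g₁ g₂ μ μ₁
  have hode := aeval_jacobiPoly_differential_equation α β n ((1 - w) ^ 2 / (4 * w))
  simp only [g, g₁, g₂, μ, μ₁]
  rw [reciprocalJacobi_derivative_derivative_eval α β n hw,
    reciprocalJacobi_derivative_eval α β n hw, reciprocalJacobi_eval α β n hw]
  generalize Polynomial.aeval ((1 - w) ^ 2 / (4 * w)) (jacobiPoly α β n).derivative.derivative
    = P₂ at *
  generalize Polynomial.aeval ((1 - w) ^ 2 / (4 * w)) (jacobiPoly α β n).derivative = P₁ at *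
  generalize Polynomial.aeval ((1 - w) ^ 2 / (4 * w)) (jacobiPoly α β n) = P₀ at *
  generalize w ^ n = W
  rw [← sub_eq_zero] at hode ⊢
  refine Eq.trans ?_ ((congrArg (W * ·) hode).trans (mul_zero W))
  field_simp
  ring

/-- The curve along which the Jacobi differential equation is integrated. -/
noncomputable def radialCurve (θ t : ℝ) : ℂ := Complex.exp (θ * Complex.I - t)

theorem hasDerivAt_radialCurve (θ t : ℝ) :
    HasDerivAt (radialCurve θ) (-radialCurve θ t) t := by
  have := ((Complex.ofRealCLM.hasDerivAt (x := t)).const_sub (θ * Complex.I)).cexp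
  exact this.congr_deriv (by simp [radialCurve])

theorem HasDerivAt.comp_radialCurve {F : ℂ → ℂ} {F' D : ℂ} {θ t : ℝ}
    (hF : HasDerivAt F F' (radialCurve θ t)) (hD : F' * -radialCurve θ t = D) :
    HasDerivAt (fun t : ℝ => F (radialCurve θ t)) D t :=
  (hF.comp t (hasDerivAt_radialCurve θ t)).congr_deriv hD

theorem radialCurve_ne_zero (θ t : ℝ) : radialCurve θ t ≠ 0 := Complex.exp_ne_zero _

theorem norm_radialCurve (θ t : ℝ) : ‖radialCurve θ t‖ = Real.exp (-t) := by
  simp [radialCurve, Complex.norm_exp]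

theorem radialCurve_zero (θ : ℝ) : radialCurve θ 0 = Complex.exp (θ * Complex.I) := by
  simp [radialCurve]

theorem radialCurve_eq (θ t : ℝ) :
    radialCurve θ t = Real.exp (-t) * Complex.exp (θ * Complex.I) := by
  rw [radialCurve, sub_eq_neg_add, Complex.exp_add]
  simp

theorem tendsto_radialCurve (θ : ℝ) :
    Filter.Tendsto (radialCurve θ) Filter.atTop (nhds 0) := by
  rw [tendsto_zero_iff_norm_tendsto_zero]
  simpa only [norm_radialCurve] using Real.tendsto_exp_neg_atTop_nhds_zero

theorem sin_le_norm_one_add_mul_exp (θ r : ℝ) :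
    Real.sin θ ≤ ‖1 + r * Complex.exp (θ * Complex.I)‖ := by
  have h : 1 + r * Complex.exp (θ * Complex.I) =
      (Complex.exp ((-θ : ℝ) * Complex.I) + r) * Complex.exp (θ * Complex.I) := by
    rw [add_mul, ← Complex.exp_add]
    simp
  rw [h, norm_mul, Complex.norm_exp_ofReal_mul_I, mul_one]
  refine le_trans (le_trans (le_abs_self _) (le_of_eq ?_)) (Complex.abs_im_le_norm _)
  rw [Complex.add_im, Complex.exp_ofReal_mul_I_im, Complex.ofReal_im, Real.sin_neg, add_zero,
    abs_neg]

theorem sin_le_norm_one_add_radialCurve (θ t : ℝ) : Real.sin θ ≤ ‖1 + radialCurve θ t‖ := by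
  rw [radialCurve_eq]
  exact sin_le_norm_one_add_mul_exp θ _

theorem sin_le_norm_one_sub_radialCurve (θ t : ℝ) : Real.sin θ ≤ ‖1 - radialCurve θ t‖ := by
  have := sin_le_norm_one_add_mul_exp θ (-Real.exp (-t))
  rwa [Complex.ofReal_neg, neg_mul, ← sub_eq_add_neg, ← radialCurve_eq] at this

theorem abs_re_radialCurve_lt_one {θ t : ℝ} (hθ : 0 < Real.sin θ) (ht : 0 ≤ t) :
    |(radialCurve θ t).re| < 1 := by
  have hc : |Real.cos θ| < 1 := by
    rw [← sq_lt_one_iff_abs_lt_one, Real.cos_sq']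
    nlinarith
  have he : Real.exp (-t) ≤ 1 := Real.exp_le_one_iff.2 (by linarith)
  rw [radialCurve_eq, Complex.re_ofReal_mul, Complex.exp_ofReal_mul_I_re, abs_mul,
    abs_of_pos (Real.exp_pos _)]
  nlinarith [abs_nonneg (Real.cos θ)]

theorem one_sub_radialCurve_mem_slitPlane {θ t : ℝ} (hθ : 0 < Real.sin θ) (ht : 0 ≤ t) :
    1 - radialCurve θ t ∈ Complex.slitPlane := by
  have := abs_lt.1 (abs_re_radialCurve_lt_one hθ ht)
  left
  simp only [Complex.sub_re, Complex.one_re]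
  linarith

theorem one_add_radialCurve_mem_slitPlane {θ t : ℝ} (hθ : 0 < Real.sin θ) (ht : 0 ≤ t) :
    1 + radialCurve θ t ∈ Complex.slitPlane := by
  have := abs_lt.1 (abs_re_radialCurve_lt_one hθ ht)
  left
  simp only [Complex.add_re, Complex.one_re]
  linarith

/-- The algebraic factor which reduces the Jacobi equation to its normal form. -/
noncomputable def jacobiFactor (a b : ℝ) (w : ℂ) : ℂ := (1 - w) ^ (a : ℂ) * (1 + w) ^ (b : ℂ)

theorem hasDerivAt_jacobiFactor (a b : ℝ) {w : ℂ} (h1 : 1 - w ∈ Complex.slitPlane)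
    (h2 : 1 + w ∈ Complex.slitPlane) :
    HasDerivAt (jacobiFactor a b) (jacobiFactor a b w * (-(a / (1 - w)) + b / (1 + w))) w := by
  have n1 := Complex.slitPlane_ne_zero h1
  have n2 := Complex.slitPlane_ne_zero h2
  have d := (((hasDerivAt_id w).const_sub 1).cpow_const (c := (a : ℂ)) h1).mul
    (((hasDerivAt_id w).const_add 1).cpow_const (c := (b : ℂ)) h2)
  refine d.congr_deriv ?_
  simp only [id, jacobiFactor]
  rw [Complex.cpow_sub _ _ n1, Complex.cpow_sub _ _ n2, Complex.cpow_one, Complex.cpow_one]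
  field_simp

theorem jacobiFactor_zero (a b : ℝ) : jacobiFactor a b 0 = 1 := by simp [jacobiFactor]

/-- The coefficient `A * (w / (1 - w)) - B * (w / (1 + w))`. -/
noncomputable def poleSum (A B : ℝ) (w : ℂ) : ℂ := A * (w / (1 - w)) - B * (w / (1 + w))

/-- The derivative of `poleSum A B` along `radialCurve θ`. -/
noncomputable def poleSumDeriv (A B : ℝ) (w : ℂ) : ℂ :=
  -A * (w / (1 - w) ^ 2) + B * (w / (1 + w) ^ 2)

/-- The second derivative of `poleSum A B` along `radialCurve θ`. -/
noncomputable def poleSumDerivTwo (A B : ℝ) (w : ℂ) : ℂ :=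
  A * (w / (1 - w) * ((1 + w) / (1 - w) ^ 2)) - B * (w / (1 + w) * ((1 - w) / (1 + w) ^ 2))

theorem hasDerivAt_poleSum (A B : ℝ) {w : ℂ} (n1 : 1 - w ≠ 0) (n2 : 1 + w ≠ 0) :
    HasDerivAt (poleSum A B) (A / (1 - w) ^ 2 - B / (1 + w) ^ 2) w := by
  have d := (((hasDerivAt_id w).div ((hasDerivAt_id w).const_sub 1) n1).const_mul (A : ℂ)).sub
    (((hasDerivAt_id w).div ((hasDerivAt_id w).const_add 1) n2).const_mul (B : ℂ))
  refine d.congr_deriv ?_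
  simp only [id]
  field_simp
  ring

theorem hasDerivAt_poleSumDeriv (A B : ℝ) {w : ℂ} (n1 : 1 - w ≠ 0) (n2 : 1 + w ≠ 0) :
    HasDerivAt (poleSumDeriv A B) (-A * ((1 + w) / (1 - w) ^ 3) + B * ((1 - w) / (1 + w) ^ 3))
      w := by
  have d := (((hasDerivAt_id w).div (((hasDerivAt_id w).const_sub 1).pow 2)
      (pow_ne_zero 2 n1)).const_mul (-A : ℂ)).add
    (((hasDerivAt_id w).div (((hasDerivAt_id w).const_add 1).pow 2)
      (pow_ne_zero 2 n2)).const_mul (B : ℂ))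
  refine d.congr_deriv ?_
  simp only [id, Pi.pow_apply]
  field_simp
  ring

theorem norm_div_le_mul {w z : ℂ} {m : ℝ} (hm : 0 < m) (hz : m ≤ ‖z‖) :
    ‖w / z‖ ≤ ‖w‖ * m⁻¹ := by
  rw [norm_div, div_eq_mul_inv]
  gcongr

theorem norm_poleSum_le (A B : ℝ) {w : ℂ} {m : ℝ} (hm : 0 < m) (h1 : m ≤ ‖1 - w‖)
    (h2 : m ≤ ‖1 + w‖) : ‖poleSum A B w‖ ≤ (|A| + |B|) * m⁻¹ * ‖w‖ := by
  refine (norm_sub_le _ _).trans ?_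
  rw [norm_mul, norm_mul, Complex.norm_real, Complex.norm_real, Real.norm_eq_abs,
    Real.norm_eq_abs]
  calc _ ≤ |A| * (‖w‖ * m⁻¹) + |B| * (‖w‖ * m⁻¹) := by
        gcongr
        exacts [norm_div_le_mul hm h1, norm_div_le_mul hm h2]
    _ = _ := by ring

theorem norm_poleSumDeriv_le (A B : ℝ) {w : ℂ} {m : ℝ} (hm : 0 < m) (h1 : m ≤ ‖1 - w‖)
    (h2 : m ≤ ‖1 + w‖) : ‖poleSumDeriv A B w‖ ≤ (|A| + |B|) * m⁻¹ ^ 2 * ‖w‖ := by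
  refine (norm_add_le _ _).trans ?_
  rw [norm_mul, norm_mul, norm_neg, Complex.norm_real, Complex.norm_real, Real.norm_eq_abs,
    Real.norm_eq_abs]
  calc _ ≤ |A| * (‖w‖ * (m ^ 2)⁻¹) + |B| * (‖w‖ * (m ^ 2)⁻¹) := by
        gcongr
        · exact norm_div_le_mul (by positivity) (by rw [norm_pow]; gcongr)
        · exact norm_div_le_mul (by positivity) (by rw [norm_pow]; gcongr)
    _ = _ := by ring

theorem norm_poleSumDerivTwo_le (A B : ℝ) {w : ℂ} {m : ℝ} (hm : 0 < m) (h1 : m ≤ ‖1 - w‖)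
    (h2 : m ≤ ‖1 + w‖) (hw : ‖w‖ ≤ 1) :
    ‖poleSumDerivTwo A B w‖ ≤ 2 * (|A| + |B|) * m⁻¹ ^ 3 * ‖w‖ := by
  refine (norm_sub_le _ _).trans ?_
  have k1 : ‖1 + w‖ ≤ 2 := by
    refine (norm_add_le _ _).trans ?_
    rw [norm_one]; linarith
  have k2 : ‖1 - w‖ ≤ 2 := by
    refine (norm_sub_le _ _).trans ?_
    rw [norm_one]; linarith
  rw [norm_mul, norm_mul (B : ℂ), Complex.norm_real, Complex.norm_real, Real.norm_eq_abs,
    Real.norm_eq_abs, norm_mul, norm_mul]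
  calc _ ≤ |A| * (‖w‖ * m⁻¹ * (2 * (m ^ 2)⁻¹)) + |B| * (‖w‖ * m⁻¹ * (2 * (m ^ 2)⁻¹)) := by
        gcongr
        · exact norm_div_le_mul hm h1
        · refine (norm_div_le_mul (m := m ^ 2) (by positivity) (by rw [norm_pow]; gcongr)).trans ?_
          gcongr
        · exact norm_div_le_mul hm h2
        · refine (norm_div_le_mul (m := m ^ 2) (by positivity) (by rw [norm_pow]; gcongr)).trans ?_
          gcongr
    _ = _ := by ring

theorem ofReal_mul_exp_cpow {r φ : ℝ} (a : ℝ) (hr : 0 < r) (h1 : -π < φ) (h2 : φ ≤ π) :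
    ((r : ℂ) * Complex.exp (φ * Complex.I)) ^ (a : ℂ) =
      ((r ^ a : ℝ) : ℂ) * Complex.exp ((a * φ : ℝ) * Complex.I) := by
  have hr' : (r : ℂ) = Complex.exp (Real.log r) := by
    rw [← Complex.ofReal_exp, Real.exp_log hr]
  rw [Real.rpow_def_of_pos hr, hr', ← Complex.exp_add,
    Complex.cpow_def_of_ne_zero (Complex.exp_ne_zero _), Complex.log_exp (by simpa) (by simpa),
    Complex.ofReal_exp, ← Complex.exp_add]
  congr 1
  push_cast
  ring

theorem exp_mul_I_eq_sq (θ : ℝ) :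
    Complex.exp (θ * Complex.I) =
      (Real.cos (θ / 2) + Real.sin (θ / 2) * Complex.I : ℂ) ^ 2 := by
  rw [Complex.ofReal_cos, Complex.ofReal_sin, ← Complex.exp_mul_I, ← Complex.exp_nat_mul]
  congr 1
  push_cast
  ring

theorem one_sub_exp_mul_I (θ : ℝ) :
    1 - Complex.exp (θ * Complex.I) =
      -(2 * Real.sin (θ / 2) * Complex.I) *
        (Real.cos (θ / 2) + Real.sin (θ / 2) * Complex.I : ℂ) := by
  have h : (Real.cos (θ / 2) : ℂ) ^ 2 + (Real.sin (θ / 2) : ℂ) ^ 2 = 1 := by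
    exact_mod_cast Real.cos_sq_add_sin_sq (θ / 2)
  rw [exp_mul_I_eq_sq]
  linear_combination -h + (Real.sin (θ / 2) : ℂ) ^ 2 * Complex.I_sq

theorem one_add_exp_mul_I (θ : ℝ) :
    1 + Complex.exp (θ * Complex.I) =
      2 * Real.cos (θ / 2) * (Real.cos (θ / 2) + Real.sin (θ / 2) * Complex.I : ℂ) := by
  have h : (Real.cos (θ / 2) : ℂ) ^ 2 + (Real.sin (θ / 2) : ℂ) ^ 2 = 1 := by
    exact_mod_cast Real.cos_sq_add_sin_sq (θ / 2)
  rw [exp_mul_I_eq_sq]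
  linear_combination -h + (Real.sin (θ / 2) : ℂ) ^ 2 * Complex.I_sq

theorem jacobiFactor_exp (a b : ℝ) {θ : ℝ} (h0 : 0 < θ) (hπ : θ < π) :
    jacobiFactor a b (Complex.exp (θ * Complex.I)) =
      (((2 * Real.sin (θ / 2)) ^ a * (2 * Real.cos (θ / 2)) ^ b : ℝ) : ℂ) *
        Complex.exp (((a + b) / 2 * θ - a / 2 * π : ℝ) * Complex.I) := by
  have hs : 0 < Real.sin (θ / 2) := Real.sin_pos_of_pos_of_lt_pi (by linarith) (by linarith)
  have hc : 0 < Real.cos (θ / 2) := Real.cos_pos_of_mem_Ioo ⟨by linarith, by linarith⟩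
  have e : (Real.cos (θ / 2) + Real.sin (θ / 2) * Complex.I : ℂ) =
      Complex.exp ((θ / 2 : ℝ) * Complex.I) := by
    rw [Complex.exp_mul_I, Complex.ofReal_cos, Complex.ofReal_sin]
  have e1 : 1 - Complex.exp (θ * Complex.I) = ((2 * Real.sin (θ / 2) : ℝ) : ℂ) *
      Complex.exp (((θ - π) / 2 : ℝ) * Complex.I) := by
    have : (((θ - π) / 2 : ℝ) * Complex.I : ℂ) =
        (θ / 2 : ℝ) * Complex.I + -(π / 2 * Complex.I) := by push_cast; ring
    rw [this, Complex.exp_add, Complex.exp_neg, Complex.exp_pi_div_two_mul_I, Complex.inv_I,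
      one_sub_exp_mul_I, e]
    push_cast
    ring
  have e2 : 1 + Complex.exp (θ * Complex.I) = ((2 * Real.cos (θ / 2) : ℝ) : ℂ) *
      Complex.exp ((θ / 2 : ℝ) * Complex.I) := by
    rw [one_add_exp_mul_I, e]
    push_cast
    ring
  rw [jacobiFactor, e1, e2, ofReal_mul_exp_cpow a (by positivity) (by linarith) (by linarith),
    ofReal_mul_exp_cpow b (by positivity) (by linarith) (by linarith), mul_mul_mul_comm,
    ← Complex.exp_add]
  push_cast
  congr 2
  ring

theorem poleSum_exp (A B : ℝ) {θ : ℝ} (hs : Real.sin (θ / 2) ≠ 0) (hc : Real.cos (θ / 2) ≠ 0) :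
    poleSum A B (Complex.exp (θ * Complex.I)) =
      ((-(A + B) / 2 : ℝ) : ℂ) +
        ((A * (Real.cos (θ / 2) / Real.sin (θ / 2)) -
          B * (Real.sin (θ / 2) / Real.cos (θ / 2))) / 2 : ℝ) * Complex.I := by
  have hu : (Real.cos (θ / 2) + Real.sin (θ / 2) * Complex.I : ℂ) ≠ 0 := by
    rw [Complex.ofReal_cos, Complex.ofReal_sin, ← Complex.exp_mul_I]
    exact Complex.exp_ne_zero _
  rw [poleSum, one_sub_exp_mul_I, one_add_exp_mul_I, exp_mul_I_eq_sq]
  push_cast [-Complex.ofReal_cos, -Complex.ofReal_sin]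
  have hs' : (Real.sin (θ / 2) : ℂ) ≠ 0 := by exact_mod_cast hs
  have hc' : (Real.cos (θ / 2) : ℂ) ≠ 0 := by exact_mod_cast hc
  generalize (Real.sin (θ / 2) : ℂ) = s at *
  generalize (Real.cos (θ / 2) : ℂ) = c at *
  have hI := Complex.I_ne_zero
  have h1 : (c + s * Complex.I) ^ 2 / (-(2 * s * Complex.I) * (c + s * Complex.I)) =
      (c / s * Complex.I - 1) / 2 := by
    field_simp
    linear_combination -c * Complex.I_sq
  have h2 : (c + s * Complex.I) ^ 2 / (2 * c * (c + s * Complex.I)) =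
      (1 + s / c * Complex.I) / 2 := by
    field_simp
  rw [h1, h2]
  ring

theorem joukowski_exp {θ : ℝ} :
    (1 - Complex.exp (θ * Complex.I)) ^ 2 / (4 * Complex.exp (θ * Complex.I)) =
      (((Real.cos θ - 1) / 2 : ℝ) : ℂ) := by
  have hu : (Real.cos (θ / 2) + Real.sin (θ / 2) * Complex.I : ℂ) ≠ 0 := by
    rw [Complex.ofReal_cos, Complex.ofReal_sin, ← Complex.exp_mul_I]
    exact Complex.exp_ne_zero _
  have h : (Real.cos θ - 1) / 2 = -Real.sin (θ / 2) ^ 2 := by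
    rw [Real.sin_sq_eq_half_sub, mul_div_cancel₀ _ two_ne_zero]
    ring
  rw [h, one_sub_exp_mul_I, exp_mul_I_eq_sq]
  push_cast [-Complex.ofReal_cos, -Complex.ofReal_sin]
  field_simp
  linear_combination 4 * (Real.sin (θ / 2) : ℂ) ^ 2 * Complex.I_sq

/-- The Jacobi polynomial in the variable `(w + 1 / w) / 2`, multiplied by `w ^ n` and by
the algebraic factor which brings its differential equation to normal form. -/
noncomputable def normalJacobi (α β : ℝ) (n : ℕ) (w : ℂ) : ℂ :=
  jacobiFactor (α + 1 / 2) (β + 1 / 2) w * (reciprocalJacobi α β n).eval w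

/-- The derivative of `normalJacobi` along `radialCurve θ`. -/
noncomputable def normalJacobiDeriv (α β : ℝ) (n : ℕ) (w : ℂ) : ℂ :=
  jacobiFactor (α + 1 / 2) (β + 1 / 2) w *
    (poleSum (α + 1 / 2) (β + 1 / 2) w * (reciprocalJacobi α β n).eval w -
      w * (reciprocalJacobi α β n).derivative.eval w)

theorem normalJacobi_exp (α β : ℝ) (n : ℕ) {θ : ℝ} (h0 : 0 < θ) (hπ : θ < π) :
    normalJacobi α β n (Complex.exp (θ * Complex.I)) =
      Complex.exp (((n + (α + β + 1) / 2) * θ - (α / 2 + 1 / 4) * π : ℝ) * Complex.I) *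
        ((2 * Real.sin (θ / 2)) ^ (α + 1 / 2) * (2 * Real.cos (θ / 2)) ^ (β + 1 / 2) *
          jacobiP α β n (Real.cos θ) : ℝ) := by
  rw [normalJacobi, jacobiFactor_exp _ _ h0 hπ,
    reciprocalJacobi_eval α β n (Complex.exp_ne_zero _), joukowski_exp,
    ← Complex.coe_algebraMap, Polynomial.aeval_algebraMap_apply, Polynomial.coe_aeval_eq_eval,
    Complex.coe_algebraMap, ← jacobiP_eq_eval, ← Complex.exp_nat_mul]
  have e : (((n + (α + β + 1) / 2) * θ - (α / 2 + 1 / 4) * π : ℝ) * Complex.I : ℂ) =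
      (((α + 1 / 2 + (β + 1 / 2)) / 2 * θ - (α + 1 / 2) / 2 * π : ℝ) * Complex.I : ℂ) +
        n * (θ * Complex.I) := by
    push_cast
    ring
  rw [e, Complex.exp_add]
  push_cast
  ring

theorem exists_normalJacobiDeriv_exp_add (α β : ℝ) (n : ℕ) {θ : ℝ} (h0 : 0 < θ) (hπ : θ < π) :
    ∃ v : ℝ, normalJacobiDeriv α β n (Complex.exp (θ * Complex.I)) +
      ((n + (α + β + 1) / 2 : ℝ) : ℂ) * normalJacobi α β n (Complex.exp (θ * Complex.I)) =
      Complex.exp (((n + (α + β + 1) / 2) * θ - (α / 2 + 1 / 4) * π : ℝ) * Complex.I) *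
        (v * Complex.I) := by
  have hs : Real.sin (θ / 2) ≠ 0 := (Real.sin_pos_of_pos_of_lt_pi (by linarith) (by linarith)).ne'
  have hc : Real.cos (θ / 2) ≠ 0 := (Real.cos_pos_of_mem_Ioo ⟨by linarith, by linarith⟩).ne'
  have hw := Complex.exp_ne_zero (θ * Complex.I)
  have h2 : (Complex.exp (θ * Complex.I) ^ 2 - 1) / (4 * Complex.exp (θ * Complex.I)) =
      (Real.sin θ / 2 : ℝ) * Complex.I := by
    have h : (Complex.exp (θ * Complex.I) ^ 2 - 1) / (4 * Complex.exp (θ * Complex.I)) =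
        (Complex.exp (θ * Complex.I) - Complex.exp (-(θ * Complex.I))) / 4 := by
      rw [Complex.exp_neg]
      field_simp
    rw [h, ← neg_mul, Complex.exp_mul_I, Complex.exp_mul_I, Complex.cos_neg, Complex.sin_neg]
    push_cast
    ring
  refine ⟨(2 * Real.sin (θ / 2)) ^ (α + 1 / 2) * (2 * Real.cos (θ / 2)) ^ (β + 1 / 2) *
    (((α + 1 / 2) * (Real.cos (θ / 2) / Real.sin (θ / 2)) -
      (β + 1 / 2) * (Real.sin (θ / 2) / Real.cos (θ / 2))) / 2 * jacobiP α β n (Real.cos θ) -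
      Real.sin θ / 2 * (jacobiPoly α β n).derivative.eval ((Real.cos θ - 1) / 2)), ?_⟩
  rw [normalJacobi, normalJacobiDeriv, jacobiFactor_exp _ _ h0 hπ, poleSum_exp _ _ hs hc,
    reciprocalJacobi_derivative_eval α β n hw, reciprocalJacobi_eval α β n hw, joukowski_exp,
    ← Complex.coe_algebraMap, Polynomial.aeval_algebraMap_apply,
    Polynomial.aeval_algebraMap_apply, Polynomial.coe_aeval_eq_eval,
    Complex.coe_algebraMap, ← jacobiP_eq_eval]
  have e : (((n + (α + β + 1) / 2) * θ - (α / 2 + 1 / 4) * π : ℝ) * Complex.I : ℂ) =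
      (((α + 1 / 2 + (β + 1 / 2)) / 2 * θ - (α + 1 / 2) / 2 * π : ℝ) * Complex.I : ℂ) +
        n * (θ * Complex.I) := by
    push_cast
    ring
  rw [e, Complex.exp_add, Complex.exp_nat_mul]
  have h3 : ∀ x : ℂ, Complex.exp (θ * Complex.I) * (n * Complex.exp (θ * Complex.I) ^ n /
      Complex.exp (θ * Complex.I) * (jacobiP α β n (Real.cos θ) : ℝ) +
      Complex.exp (θ * Complex.I) ^ n * (x * ((Complex.exp (θ * Complex.I) ^ 2 - 1) /
        (4 * Complex.exp (θ * Complex.I) ^ 2)))) = Complex.exp (θ * Complex.I) ^ n *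
      (n * (jacobiP α β n (Real.cos θ) : ℝ) + x * ((Real.sin θ / 2 : ℝ) * Complex.I)) := by
    intro x
    rw [← h2]
    field_simp
  rw [h3]
  push_cast
  ring

theorem tendsto_normalJacobi (α β : ℝ) (n : ℕ) (θ : ℝ) :
    Filter.Tendsto (fun t => normalJacobi α β n (radialCurve θ t)) Filter.atTop
      (nhds ((jacobiCoeff α β n n / 4 ^ n : ℝ) : ℂ)) := by
  have hA : ContinuousAt (jacobiFactor (α + 1 / 2) (β + 1 / 2)) 0 :=
    (hasDerivAt_jacobiFactor _ _ (by simp) (by simp)).continuousAt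
  have h : ContinuousAt (normalJacobi α β n) 0 :=
    hA.mul (reciprocalJacobi α β n).continuous.continuousAt
  have := h.tendsto.comp (tendsto_radialCurve θ)
  rwa [normalJacobi, jacobiFactor_zero, one_mul, reciprocalJacobi_eval_zero] at this

theorem tendsto_normalJacobiDeriv (α β : ℝ) (n : ℕ) (θ : ℝ) :
    Filter.Tendsto (fun t => normalJacobiDeriv α β n (radialCurve θ t)) Filter.atTop
      (nhds 0) := by
  have hA : ContinuousAt (jacobiFactor (α + 1 / 2) (β + 1 / 2)) 0 :=
    (hasDerivAt_jacobiFactor _ _ (by simp) (by simp)).continuousAt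
  have hp : ContinuousAt (poleSum (α + 1 / 2) (β + 1 / 2)) 0 :=
    (hasDerivAt_poleSum _ _ (by simp) (by simp)).continuousAt
  have h : ContinuousAt (normalJacobiDeriv α β n) 0 :=
    hA.mul ((hp.mul (reciprocalJacobi α β n).continuous.continuousAt).sub
      (continuousAt_id.mul (reciprocalJacobi α β n).derivative.continuous.continuousAt))
  have := h.tendsto.comp (tendsto_radialCurve θ)
  rwa [show normalJacobiDeriv α β n 0 = 0 by simp [normalJacobiDeriv, poleSum]] at this

theorem hasDerivAt_normalJacobi (α β : ℝ) (n : ℕ) {θ t : ℝ} (hθ : 0 < Real.sin θ) (ht : 0 ≤ t) :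
    HasDerivAt (fun t => normalJacobi α β n (radialCurve θ t))
      (normalJacobiDeriv α β n (radialCurve θ t)) t := by
  have s1 := one_sub_radialCurve_mem_slitPlane hθ ht
  have s2 := one_add_radialCurve_mem_slitPlane hθ ht
  have n1 := Complex.slitPlane_ne_zero s1
  have n2 := Complex.slitPlane_ne_zero s2
  refine ((hasDerivAt_jacobiFactor (α + 1 / 2) (β + 1 / 2) s1 s2).mul
    ((reciprocalJacobi α β n).hasDerivAt _)).comp_radialCurve ?_
  rw [normalJacobiDeriv, poleSum]
  ring

theorem hasDerivAt_normalJacobiDeriv (α β : ℝ) (n : ℕ) {θ t : ℝ} (hθ : 0 < Real.sin θ)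
    (ht : 0 ≤ t) :
    HasDerivAt (fun t => normalJacobiDeriv α β n (radialCurve θ t))
      (poleSumDeriv (1 / 4 - α ^ 2) (1 / 4 - β ^ 2) (radialCurve θ t) *
        normalJacobi α β n (radialCurve θ t) -
        2 * (n + (α + β + 1) / 2 : ℝ) * normalJacobiDeriv α β n (radialCurve θ t)) t := by
  have s1 := one_sub_radialCurve_mem_slitPlane hθ ht
  have s2 := one_add_radialCurve_mem_slitPlane hθ ht
  have n1 := Complex.slitPlane_ne_zero s1
  have n2 := Complex.slitPlane_ne_zero s2
  have hode := reciprocalJacobi_differential_equation α β n (radialCurve_ne_zero θ t) n1 n2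
  refine ((hasDerivAt_jacobiFactor (α + 1 / 2) (β + 1 / 2) s1 s2).mul
    (((hasDerivAt_poleSum (α + 1 / 2) (β + 1 / 2) n1 n2).mul
      ((reciprocalJacobi α β n).hasDerivAt _)).sub
      ((hasDerivAt_id _).mul ((reciprocalJacobi α β n).derivative.hasDerivAt _)))).comp_radialCurve
      ?_
  simp only [normalJacobi, normalJacobiDeriv, poleSum, poleSumDeriv, id, Pi.mul_apply,
    Pi.sub_apply] at hode ⊢
  push_cast
  linear_combination jacobiFactor (α + 1 / 2) (β + 1 / 2) (radialCurve θ t) * hode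

/-- The second order asymptotic formula, normalised by the leading coefficient. -/
theorem abs_jacobiP_sub_le (α β : ℝ) (n : ℕ) {θ m B : ℝ} (h0 : 0 < θ) (hπ : θ < π)
    (hm : 0 < m) (hmθ : m ≤ Real.sin θ)
    (hB : 2 * (|1 / 4 - α ^ 2| + |1 / 4 - β ^ 2|) * m⁻¹ ^ 3 = B)
    (hL : 0 ≤ jacobiCoeff α β n n) (hκ : 1 ≤ (n : ℝ) + (α + β + 1) / 2)
    (hκB : 3 * B ≤ (n : ℝ) + (α + β + 1) / 2) :
    |(2 * Real.sin (θ / 2)) ^ (α + 1 / 2) * (2 * Real.cos (θ / 2)) ^ (β + 1 / 2) *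
        jacobiP α β n (Real.cos θ) - 2 * (jacobiCoeff α β n n / 4 ^ n) *
      (Real.cos (((n : ℝ) + (α + β + 1) / 2) * θ - (α / 2 + 1 / 4) * π) *
          (1 - (1 / 2 - α ^ 2 - β ^ 2) / (4 * ((n : ℝ) + (α + β + 1) / 2))) -
        Real.sin (((n : ℝ) + (α + β + 1) / 2) * θ - (α / 2 + 1 / 4) * π) *
          (2 * α ^ 2 - 2 * β ^ 2 + (2 * α ^ 2 + 2 * β ^ 2 - 1) * Real.cos θ) /
            (8 * ((n : ℝ) + (α + β + 1) / 2) * Real.sin θ))| ≤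
      (14 * B + 9 * B ^ 2) * (jacobiCoeff α β n n / 4 ^ n) / ((n : ℝ) + (α + β + 1) / 2) ^ 2 := by
  have hs : Real.sin (θ / 2) ≠ 0 := (Real.sin_pos_of_pos_of_lt_pi (by linarith) (by linarith)).ne'
  have hc : Real.cos (θ / 2) ≠ 0 := (Real.cos_pos_of_mem_Ioo ⟨by linarith, by linarith⟩).ne'
  have hθ : 0 < Real.sin θ := hm.trans_le hmθ
  have hm1 : 1 ≤ m⁻¹ := (one_le_inv₀ hm).2 (hmθ.trans (Real.sin_le_one θ))
  obtain ⟨v, hv⟩ := exists_normalJacobiDeriv_exp_add α β n h0 hπ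
  have n1 : ∀ t, 0 ≤ t → 1 - radialCurve θ t ≠ 0 := fun t ht =>
    Complex.slitPlane_ne_zero (one_sub_radialCurve_mem_slitPlane hθ ht)
  have n2 : ∀ t, 0 ≤ t → 1 + radialCurve θ t ≠ 0 := fun t ht =>
    Complex.slitPlane_ne_zero (one_add_radialCurve_mem_slitPlane hθ ht)
  have b1 : ∀ t, m ≤ ‖1 - radialCurve θ t‖ := fun t =>
    hmθ.trans (sin_le_norm_one_sub_radialCurve θ t)
  have b2 : ∀ t, m ≤ ‖1 + radialCurve θ t‖ := fun t =>
    hmθ.trans (sin_le_norm_one_add_radialCurve θ t)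
  have main := abs_sub_le_of_hasDerivAt (h := fun t => normalJacobi α β n (radialCurve θ t))
    (h₁ := fun t => normalJacobiDeriv α β n (radialCurve θ t))
    (Q := fun t => poleSum (1 / 4 - α ^ 2) (1 / 4 - β ^ 2) (radialCurve θ t))
    (q := fun t => poleSumDeriv (1 / 4 - α ^ 2) (1 / 4 - β ^ 2) (radialCurve θ t))
    (q₁ := fun t => poleSumDerivTwo (1 / 4 - α ^ 2) (1 / 4 - β ^ 2) (radialCurve θ t))
    (L := jacobiCoeff α β n n / 4 ^ n) (κ := n + (α + β + 1) / 2) (B := B) (v := v)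
    (U := (2 * Real.sin (θ / 2)) ^ (α + 1 / 2) * (2 * Real.cos (θ / 2)) ^ (β + 1 / 2) *
          jacobiP α β n (Real.cos θ))
    (e := Complex.exp (((n + (α + β + 1) / 2) * θ - (α / 2 + 1 / 4) * π : ℝ) * Complex.I))
    (Complex.norm_exp_ofReal_mul_I _) (by positivity) hκ hκB
    (fun t ht => hasDerivAt_normalJacobi α β n hθ ht)
    (fun t ht => hasDerivAt_normalJacobiDeriv α β n hθ ht)
    (fun t ht => (hasDerivAt_poleSum _ _ (n1 t ht) (n2 t ht)).comp_radialCurve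
      (by rw [poleSumDeriv]; ring))
    (fun t ht => (hasDerivAt_poleSumDeriv _ _ (n1 t ht) (n2 t ht)).comp_radialCurve
      (by
        have := n1 t ht
        have := n2 t ht
        rw [poleSumDerivTwo]
        field_simp
        ring))
    (fun t ht => by
      refine (norm_poleSum_le _ _ hm (b1 t) (b2 t)).trans ?_
      rw [norm_radialCurve, ← hB]
      gcongr
      · linarith [add_nonneg (abs_nonneg (1 / 4 - α ^ 2)) (abs_nonneg (1 / 4 - β ^ 2))]
      · exact le_self_pow₀ hm1 (by norm_num))
    (fun t ht => by
      refine (norm_poleSumDeriv_le _ _ hm (b1 t) (b2 t)).trans ?_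
      rw [norm_radialCurve, ← hB]
      gcongr
      · linarith [add_nonneg (abs_nonneg (1 / 4 - α ^ 2)) (abs_nonneg (1 / 4 - β ^ 2))]
      · norm_num)
    (fun t ht => by
      refine (norm_poleSumDerivTwo_le _ _ hm (b1 t) (b2 t) ?_).trans ?_
      · rw [norm_radialCurve]
        exact Real.exp_le_one_iff.2 (by linarith)
      · rw [norm_radialCurve, ← hB])
    (tendsto_normalJacobi α β n θ) (tendsto_normalJacobiDeriv α β n θ)
    (by rw [radialCurve_zero]; exact normalJacobi_exp α β n h0 hπ)
    (by rw [radialCurve_zero]; exact hv)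
  rw [radialCurve_zero, poleSum_exp _ _ hs hc] at main
  convert main using 4
  set κ : ℝ := n + (α + β + 1) / 2
  set χ : ℝ := κ * θ - (α / 2 + 1 / 4) * π
  have e1 : (1 + (((-(1 / 4 - α ^ 2 + (1 / 4 - β ^ 2)) / 2 : ℝ) : ℂ) +
      ((((1 / 4 - α ^ 2) * (Real.cos (θ / 2) / Real.sin (θ / 2)) -
        (1 / 4 - β ^ 2) * (Real.sin (θ / 2) / Real.cos (θ / 2))) / 2 : ℝ) : ℂ) * Complex.I) /
        (2 * κ)) = ((1 - (1 / 2 - α ^ 2 - β ^ 2) / (4 * κ) : ℝ) : ℂ) +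
      ((-(2 * α ^ 2 - 2 * β ^ 2 + (2 * α ^ 2 + 2 * β ^ 2 - 1) * Real.cos θ) /
            (8 * κ * Real.sin θ) : ℝ) : ℂ) * Complex.I := by
    have e2 : ((1 / 4 - α ^ 2) * (Real.cos (θ / 2) / Real.sin (θ / 2)) -
        (1 / 4 - β ^ 2) * (Real.sin (θ / 2) / Real.cos (θ / 2))) / 2 =
        2 * κ * (-(2 * α ^ 2 - 2 * β ^ 2 + (2 * α ^ 2 + 2 * β ^ 2 - 1) * Real.cos θ) /
            (8 * κ * Real.sin θ)) := by
      have hs2 : Real.sin θ = 2 * Real.sin (θ / 2) * Real.cos (θ / 2) := by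
        rw [← Real.sin_two_mul, mul_div_cancel₀ _ two_ne_zero]
      have hc2 : Real.cos θ = Real.cos (θ / 2) ^ 2 - Real.sin (θ / 2) ^ 2 := by
        rw [← Real.cos_two_mul', mul_div_cancel₀ _ two_ne_zero]
      have h1 := Real.cos_sq_add_sin_sq (θ / 2)
      have hκ' : κ ≠ 0 := by positivity
      rw [hs2, hc2]
      field_simp
      linear_combination (16 * β ^ 2 - 16 * α ^ 2) * h1
    have hκC : (κ : ℂ) ≠ 0 := by exact_mod_cast (by positivity : κ ≠ 0)
    rw [e2]
    push_cast
    field_simp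
    ring
  rw [e1, ← Complex.exp_conj, map_mul, Complex.conj_ofReal, Complex.conj_I, mul_neg, ← neg_mul,
    ← Complex.ofReal_neg, Complex.mul_re, Complex.exp_ofReal_mul_I_re, Complex.exp_ofReal_mul_I_im,
    Real.cos_neg, Real.sin_neg]
  simp only [Complex.add_re, Complex.add_im, Complex.mul_re, Complex.mul_im, Complex.ofReal_re,
    Complex.ofReal_im, Complex.I_re, Complex.I_im]
  ring

/-- Multiplication of a two-term expansion of an amplitude with a two-term oscillating expansion. -/
theorem abs_sub_le_of_expansions {G r κ x y E c₁ c₂ C D K : ℝ} (hκ : 1 ≤ κ) (hx : |x| ≤ 1)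
    (hy : |y| ≤ 1) (hK : 0 ≤ K) (hr : |r - 1 - c₁ / κ| ≤ C / κ ^ 2) (hE : |E| ≤ D / κ)
    (hG : |G - r * (x * (1 - c₂ / κ) - y * E)| ≤ K * r / κ ^ 2) :
    |G - (x * (1 + (c₁ - c₂) / κ) - y * E)| ≤
      (K * (1 + |c₁| + C) + C * (1 + |c₂| + D) + |c₁| * |c₂| + |c₁| * D) / κ ^ 2 := by
  have hκ0 : 0 < κ := by linarith
  have hC : 0 ≤ C := by
    have := (abs_nonneg _).trans hr
    rwa [le_div_iff₀ (by positivity), zero_mul] at this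
  have hD : 0 ≤ D := by
    have := (abs_nonneg _).trans hE
    rwa [le_div_iff₀ hκ0, zero_mul] at this
  have hdiv : ∀ {z : ℝ}, 0 ≤ z → z / κ ≤ z := fun hz => div_le_self hz hκ
  have hrle : r ≤ 1 + |c₁| + C := by
    have h1 : c₁ / κ ≤ |c₁| := (le_abs_self _).trans (by
      rw [abs_div, abs_of_pos hκ0]; exact hdiv (abs_nonneg _))
    have h2 : C / κ ^ 2 ≤ C := div_le_self hC (one_le_pow₀ hκ)
    linarith [(abs_le.1 hr).2]
  have hyE : |y * E| ≤ D / κ := by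
    rw [abs_mul]
    exact (mul_le_of_le_one_left (abs_nonneg _) hy).trans hE
  have hM : |x * (1 - c₂ / κ) - y * E| ≤ 1 + |c₂| + D := by
    refine (abs_sub _ _).trans (add_le_add ?_ (hyE.trans (hdiv hD)))
    rw [abs_mul]
    refine (mul_le_of_le_one_left (abs_nonneg _) hx).trans ((abs_sub _ _).trans ?_)
    rw [abs_one, abs_div, abs_of_pos hκ0]
    gcongr
    exact hdiv (abs_nonneg _)
  have t1 : |(r - 1 - c₁ / κ) * (x * (1 - c₂ / κ) - y * E)| ≤ C / κ ^ 2 * (1 + |c₂| + D) := by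
    rw [abs_mul]
    gcongr
  have t2 : |x * (c₁ * c₂ / κ ^ 2)| ≤ |c₁| * |c₂| / κ ^ 2 := by
    rw [abs_mul, abs_div, abs_mul, abs_of_pos (by positivity : 0 < κ ^ 2)]
    exact mul_le_of_le_one_left (by positivity) hx
  have t3 : |c₁ / κ * (y * E)| ≤ |c₁| / κ * (D / κ) := by
    rw [abs_mul, abs_div, abs_of_pos hκ0]
    gcongr
  have t4 : K * r / κ ^ 2 ≤ K * (1 + |c₁| + C) / κ ^ 2 := by gcongr
  calc |G - (x * (1 + (c₁ - c₂) / κ) - y * E)|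
      = |(G - r * (x * (1 - c₂ / κ) - y * E)) + (r - 1 - c₁ / κ) * (x * (1 - c₂ / κ) - y * E) -
          x * (c₁ * c₂ / κ ^ 2) - c₁ / κ * (y * E)| := by
        congr 1
        field_simp
        ring
    _ ≤ |G - r * (x * (1 - c₂ / κ) - y * E)| +
          |(r - 1 - c₁ / κ) * (x * (1 - c₂ / κ) - y * E)| +
          |x * (c₁ * c₂ / κ ^ 2)| + |c₁ / κ * (y * E)| :=
        (abs_sub _ _).trans (add_le_add_left ((abs_sub _ _).trans
          (add_le_add_left (abs_add_le _ _) _)) _)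
    _ ≤ K * (1 + |c₁| + C) / κ ^ 2 + C / κ ^ 2 * (1 + |c₂| + D) + |c₁| * |c₂| / κ ^ 2 +
          |c₁| / κ * (D / κ) := by
        linarith
    _ = _ := by
        field_simp

theorem abs_oscillation_coeff_le (α β : ℝ) {θ m κ : ℝ} (hm : 0 < m) (hmθ : m ≤ Real.sin θ)
    (hκ : 0 < κ) :
    |(2 * α ^ 2 - 2 * β ^ 2 + (2 * α ^ 2 + 2 * β ^ 2 - 1) * Real.cos θ) /
      (8 * κ * Real.sin θ)| ≤ (4 * α ^ 2 + 4 * β ^ 2 + 1) / (8 * m) / κ := by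
  have h : |2 * α ^ 2 - 2 * β ^ 2 + (2 * α ^ 2 + 2 * β ^ 2 - 1) * Real.cos θ| ≤
      4 * α ^ 2 + 4 * β ^ 2 + 1 := by
    have h1 := Real.neg_one_le_cos θ
    have h2 := Real.cos_le_one θ
    rw [abs_le]
    constructor <;> nlinarith [sq_nonneg α, sq_nonneg β]
  have hθ : 0 < Real.sin θ := hm.trans_le hmθ
  rw [abs_div, abs_of_pos (by positivity : 0 < 8 * κ * Real.sin θ), div_div]
  refine div_le_div₀ (by positivity) h (by positivity) ?_
  have := mul_le_mul_of_nonneg_left hmθ (by positivity : 0 ≤ 8 * κ)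
  linarith

theorem sin_le_sin_of_mem_Icc {δ θ : ℝ} (hδ : -(π / 2) ≤ δ) (hθ : θ ∈ Set.Icc δ (π - δ)) :
    Real.sin δ ≤ Real.sin θ := by
  obtain ⟨h1, h2⟩ := hθ
  rcases le_total θ (π / 2) with h | h
  · exact Real.sin_le_sin_of_le_of_le_pi_div_two hδ h h1
  · rw [← Real.sin_pi_sub θ]
    exact Real.sin_le_sin_of_le_of_le_pi_div_two hδ (by linarith) (by linarith)

theorem jacobiCoeff_self_div (α β : ℝ) (n : ℕ) :
    jacobiCoeff α β n n / 4 ^ n = 2 ^ (α + β) * scaledLeadingCoeff (α + β) n := by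
  have : (0 : ℝ) < 2 ^ (α + β) := by positivity
  simp only [jacobiCoeff, scaledLeadingCoeff, Nat.sub_self, ascPochhammer_zero,
    Polynomial.eval_one, Nat.factorial_zero, Nat.cast_one, mul_one, ← add_assoc]
  field_simp

theorem jacobi_elementary_second_order (α β : ℝ) (hα : -1 < α) (hβ : -1 < β)
    (δ : ℝ) (hδ : δ ∈ Set.Ioo 0 (π / 2)) :
    ∃ C > (0 : ℝ), ∃ N : ℕ, ∀ n : ℕ, N ≤ n → ∀ θ ∈ Set.Icc δ (π - δ),
      |Real.sqrt (π * ((n : ℝ) + (α + β + 1) / 2)) *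
          (Real.sin (θ / 2)) ^ (α + 1 / 2) * (Real.cos (θ / 2)) ^ (β + 1 / 2) *
          jacobiP α β n (Real.cos θ) -
          (Real.cos (((n : ℝ) + (α + β + 1) / 2) * θ - (α / 2 + 1 / 4) * π) *
              (1 - α * β / (2 * ((n : ℝ) + (α + β + 1) / 2))) -
            Real.sin (((n : ℝ) + (α + β + 1) / 2) * θ - (α / 2 + 1 / 4) * π) *
              (2 * α ^ 2 - 2 * β ^ 2 + (2 * α ^ 2 + 2 * β ^ 2 - 1) * Real.cos θ) /
              (8 * ((n : ℝ) + (α + β + 1) / 2) * Real.sin θ))| ≤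
        C / ((n : ℝ) + (α + β + 1) / 2) ^ 2 := by
  obtain ⟨hδ0, hδ2⟩ := hδ
  have hm : 0 < Real.sin δ := Real.sin_pos_of_pos_of_lt_pi hδ0 (by linarith)
  obtain ⟨C₀, hC₀⟩ := exists_abs_scaledLeadingCoeff_sub_le (s := α + β) (by linarith)
  set B : ℝ := 2 * (|1 / 4 - α ^ 2| + |1 / 4 - β ^ 2|) * (Real.sin δ)⁻¹ ^ 3 with hB
  set D : ℝ := (4 * α ^ 2 + 4 * β ^ 2 + 1) / (8 * Real.sin δ) with hD
  set c₁ : ℝ := 1 / 8 - (α + β) ^ 2 / 4 with hc₁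
  set c₂ : ℝ := (1 / 2 - α ^ 2 - β ^ 2) / 4 with hc₂
  set K : ℝ := (14 * B + 9 * B ^ 2) / 2 with hK
  have hB0 : 0 ≤ B := by positivity
  obtain ⟨N, hN⟩ := Filter.eventually_atTop.1 (hC₀.and ((Filter.eventually_ge_atTop 1).and
    ((eventually_le_natCast_add 1 ((α + β + 1) / 2)).and
      (eventually_le_natCast_add (3 * B) ((α + β + 1) / 2)))))
  have hCpos : 0 ≤ C₀ := by
    obtain ⟨h1, -, h3, -⟩ := hN N le_rfl
    have := (abs_nonneg _).trans h1
    rwa [le_div_iff₀ (by positivity), zero_mul] at this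
  refine ⟨K * (1 + |c₁| + C₀) + C₀ * (1 + |c₂| + D) + |c₁| * |c₂| + |c₁| * D + 1, by positivity,
    N, fun n hn θ hθ => ?_⟩
  obtain ⟨hr, hn1, hκ, hκB⟩ := hN n hn
  have hθ0 : 0 < θ := hδ0.trans_le hθ.1
  have hθπ : θ < π := by linarith [hθ.2]
  have hs : 0 < Real.sin (θ / 2) := Real.sin_pos_of_pos_of_lt_pi (by linarith) (by linarith)
  have hc : 0 < Real.cos (θ / 2) := Real.cos_pos_of_mem_Ioo ⟨by linarith, by linarith⟩
  have hmθ : Real.sin δ ≤ Real.sin θ := sin_le_sin_of_mem_Icc (by linarith) hθ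
  have hS := scaledLeadingCoeff_pos (s := α + β) (by linarith) hn1
  have hL : 0 ≤ jacobiCoeff α β n n := by
    have h : 0 ≤ jacobiCoeff α β n n / 4 ^ n := by
      rw [jacobiCoeff_self_div]
      positivity
    rwa [le_div_iff₀ (by positivity), zero_mul] at h
  have main := abs_jacobiP_sub_le α β n hθ0 hθπ hm hmθ hB.symm hL hκ hκB
  rw [jacobiCoeff_self_div, Real.mul_rpow two_pos.le hs.le, Real.mul_rpow two_pos.le hc.le] at main
  set κ : ℝ := n + (α + β + 1) / 2
  set S := scaledLeadingCoeff (α + β) n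
  set x := Real.cos (κ * θ - (α / 2 + 1 / 4) * π)
  set y := Real.sin (κ * θ - (α / 2 + 1 / 4) * π)
  have hκ0 : 0 < κ := by linarith
  have hE : |(2 * α ^ 2 - 2 * β ^ 2 + (2 * α ^ 2 + 2 * β ^ 2 - 1) * Real.cos θ) /
      (8 * κ * Real.sin θ)| ≤ D / κ :=
    abs_oscillation_coeff_le α β hm hmθ hκ0
  have hG : |Real.sqrt (π * κ) * Real.sin (θ / 2) ^ (α + 1 / 2) * Real.cos (θ / 2) ^ (β + 1 / 2) *
      jacobiP α β n (Real.cos θ) - Real.sqrt (π * κ) * S * (x * (1 - c₂ / κ) -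
        y * ((2 * α ^ 2 - 2 * β ^ 2 + (2 * α ^ 2 + 2 * β ^ 2 - 1) * Real.cos θ) /
          (8 * κ * Real.sin θ)))| ≤ K * (Real.sqrt (π * κ) * S) / κ ^ 2 := by
    have h2 : (0 : ℝ) < 2 ^ (α + β) := by positivity
    have h2ab : (2 : ℝ) ^ (α + 1 / 2) * 2 ^ (β + 1 / 2) = 2 * 2 ^ (α + β) := by
      rw [← Real.rpow_add two_pos, show α + 1 / 2 + (β + 1 / 2) = 1 + (α + β) by ring,
        Real.rpow_add two_pos, Real.rpow_one]
    have hfac : 0 ≤ Real.sqrt (π * κ) / (2 * 2 ^ (α + β)) := by positivity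
    have h := mul_le_mul_of_nonneg_left main hfac
    rw [← abs_of_nonneg hfac, ← abs_mul, abs_of_nonneg hfac] at h
    refine le_of_eq_of_le (congrArg abs ?_) (h.trans_eq ?_)
    · rw [mul_mul_mul_comm ((2 : ℝ) ^ (α + 1 / 2)), h2ab, hc₂]
      field_simp
    · rw [hK]
      field_simp
  have fin := abs_sub_le_of_expansions hκ (Real.abs_cos_le_one _) (Real.abs_sin_le_one _)
    (by positivity) hr hE hG
  have hcc : (c₁ - c₂) / κ = -(α * β / (2 * κ)) := by
    rw [hc₁, hc₂]
    field_simp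
    ring
  rw [hcc, ← sub_eq_add_neg, ← mul_div_assoc] at fin
  exact fin.trans (div_le_div_of_nonneg_right (le_add_of_nonneg_right zero_le_one) (sq_nonneg κ))
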